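/- arXiv:2211.02472 — 2 statements merged into one kernel-verified Lean document; each statement's English description precedes it below -/
import Mathlib

section
/- Suppose a ≥ 1/2 and L satisfies Assumptions A1 and A2. Then for any sequence M_n → ∞, the empirical Bayes posterior contracts around the true parameter and around the empirical Bayes posterior mean at the near-minimax rate: sup_{θ0 ∈ ℓ0[q_n]} E_{θ0} Π_{τ̂}( θ : ‖θ − θ0‖² > M_n q_n log n | X ) → 0 and sup_{θ0 ∈ ℓ0[q_n]} E_{θ0} Π_{τ̂}( θ : ‖θ − T_{τ̂}(X)‖² > M_n q_n log n | X ) → 0 as n → ∞, where T_{τ̂}(X) = (T_{τ̂}(X_1),…,T_{τ̂}(X_n)). -/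
open MeasureTheory ProbabilityTheory Real Filter Set

noncomputable section

namespace PaperGL

/-- Posterior density kernel of the shrinkage coefficient `κ` given `(x, τ)`:
`π(κ | x, τ) ∝ κ^(a-1/2) (1-κ)^(-a-1) L(τ⁻²(κ⁻¹-1)) exp((1-κ)x²/2)` on `(0,1)`. -/
def kdens (a : ℝ) (L : ℝ → ℝ) (x τ κ : ℝ) : ℝ :=
  κ ^ (a - 1/2) * (1 - κ) ^ (-a - 1) * L ((1/τ^2) * (1/κ - 1)) * Real.exp ((1 - κ) * x^2 / 2)

/-- Posterior expectation of `g(κ)` given `(x, τ)`. -/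
def kExp (a : ℝ) (L : ℝ → ℝ) (x τ : ℝ) (g : ℝ → ℝ) : ℝ :=
  (∫ κ in Set.Ioo (0:ℝ) 1, g κ * kdens a L x τ κ) /
    (∫ κ in Set.Ioo (0:ℝ) 1, kdens a L x τ κ)

/-- `E(1−κ | x, τ)`. -/
def E1mK (a : ℝ) (L : ℝ → ℝ) (x τ : ℝ) : ℝ := kExp a L x τ (fun κ => 1 - κ)

/-- Posterior mean `T_τ(x) = x · E(1−κ | x, τ)`. -/
def postMean (a : ℝ) (L : ℝ → ℝ) (τ x : ℝ) : ℝ := x * E1mK a L x τ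

/-- Posterior variance `Var(θ | x, τ)` of the mixture over `κ` of `N((1−κ)x, 1−κ)`. -/
def postVar (a : ℝ) (L : ℝ → ℝ) (x τ : ℝ) : ℝ :=
  E1mK a L x τ + x^2 * (kExp a L x τ (fun κ => (1 - κ)^2) - (E1mK a L x τ)^2)

/-- `E(1−κ | x, τ)` in the `t = τ⁻²(κ⁻¹−1)` parametrisation. -/
def E1mKt (a : ℝ) (L : ℝ → ℝ) (x τ : ℝ) : ℝ :=
  (τ^2 * ∫ t in Set.Ioi (0:ℝ),
      (1 + t*τ^2) ^ (-(3:ℝ)/2) * t ^ (-a) * L t * Real.exp ((x^2/2) * (t*τ^2/(1+t*τ^2)))) /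
  (∫ t in Set.Ioi (0:ℝ),
      (1 + t*τ^2) ^ (-(1:ℝ)/2) * t ^ (-a-1) * L t * Real.exp ((x^2/2) * (t*τ^2/(1+t*τ^2))))

/-- The empirical Bayes estimate `τ̂` of the global shrinkage parameter. -/
def tauHat (c1 c2 : ℝ) (n : ℕ) (x : Fin n → ℝ) : ℝ :=
  max (1/(n:ℝ)) ((1/(c2*n)) * ∑ i, if Real.sqrt (c1 * Real.log n) < |x i| then (1:ℝ) else 0)

/-- Nearly black vectors: `θ ∈ ℓ₀[q]`. -/
def sparse (n q : ℕ) (θ : Fin n → ℝ) : Prop := Nat.card {i : Fin n // θ i ≠ 0} ≤ q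

/-- The sampling distribution `N_n(θ₀, I_n)`. -/
def Pmeas (n : ℕ) (θ0 : Fin n → ℝ) : Measure (Fin n → ℝ) :=
  Measure.pi fun i => gaussianReal (θ0 i) 1

/-- `q_n ∝ n^β` (two-sided proportionality). -/
def propTo (q : ℕ → ℕ) (β : ℝ) : Prop :=
  ∃ k1 k2 : ℝ, 0 < k1 ∧ 0 < k2 ∧
    ∀ᶠ n : ℕ in atTop, k1 * (n:ℝ)^β ≤ (q n : ℝ) ∧ (q n : ℝ) ≤ k2 * (n:ℝ)^β

/-- `p_n ∝ n^(-e)` for a real sequence. -/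
def propToR (p : ℕ → ℝ) (β : ℝ) : Prop :=
  ∃ k1 k2 : ℝ, 0 < k1 ∧ 0 < k2 ∧
    ∀ᶠ n : ℕ in atTop, k1 * (n:ℝ)^β ≤ p n ∧ p n ≤ k2 * (n:ℝ)^β

/-- Assumptions (A1) and (A2) on the slowly varying function `L`, together with
positivity, measurability. -/
def AssumpL (L : ℝ → ℝ) (Mb c0 t0 : ℝ) : Prop :=
  Measurable L ∧ (∀ t, 0 < t → 0 < L t) ∧ (∀ t, 0 < t → L t ≤ Mb) ∧
    0 < c0 ∧ 0 < t0 ∧ ∀ t, t0 ≤ t → c0 ≤ L t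

/-- Integrability of `t^(−a−1) L t` on `(0,∞)` with positive integral, and `K` its inverse. -/
def Kcond (a : ℝ) (L : ℝ → ℝ) (K : ℝ) : Prop :=
  MeasureTheory.IntegrableOn (fun t => t ^ (-a-1) * L t) (Set.Ioi (0:ℝ)) ∧
    0 < ∫ t in Set.Ioi (0:ℝ), t ^ (-a-1) * L t ∧
    K = (∫ t in Set.Ioi (0:ℝ), t ^ (-a-1) * L t)⁻¹

/-- The κ-posterior as a probability measure on `(0,1)`. -/
def kPostMeasure (a : ℝ) (L : ℝ → ℝ) (x τ : ℝ) : Measure ℝ :=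
  (∫⁻ κ in Set.Ioo (0:ℝ) 1, ENNReal.ofReal (kdens a L x τ κ))⁻¹ •
    ((volume.restrict (Set.Ioo (0:ℝ) 1)).withDensity fun κ => ENNReal.ofReal (kdens a L x τ κ))

/-- The posterior distribution of `θ` given `(x, τ)`: mixture over `κ` of `N((1−κ)x, 1−κ)`. -/
def thetaPost (a : ℝ) (L : ℝ → ℝ) (x τ : ℝ) : Measure ℝ :=
  (kPostMeasure a L x τ).bind fun κ => gaussianReal ((1-κ)*x) (Real.toNNReal (1-κ))

/-- `Π_τ(· | X)`: the posterior of the vector `θ` given `(X, τ)`. -/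
def PiTau (a : ℝ) (L : ℝ → ℝ) (n : ℕ) (X : Fin n → ℝ) (τ : ℝ) : Measure (Fin n → ℝ) :=
  Measure.pi fun i => thetaPost a L (X i) τ

/-- Marginal density `m(x, τ)` of one observation given `τ` (mixing over `l = λ²`). -/
def marg (a K : ℝ) (L : ℝ → ℝ) (x τ : ℝ) : ℝ :=
  ∫ l in Set.Ioi (0:ℝ), K * l ^ (-a-1) * L l *
    ((Real.sqrt (2 * Real.pi * (1 + l * τ^2)))⁻¹ * Real.exp (-(x^2) / (2 * (1 + l * τ^2))))

/-- Posterior density of `τ` given `X`, for a prior `π2` supported on `[lo, hi]`. -/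
def tauWeight (a K : ℝ) (L : ℝ → ℝ) (π2 : ℝ → ℝ) (lo hi : ℝ) (n : ℕ)
    (X : Fin n → ℝ) (τ : ℝ) : ℝ :=
  (π2 τ * ∏ i, marg a K L (X i) τ) /
    ∫ s in Set.Icc lo hi, π2 s * ∏ i, marg a K L (X i) s

/-- Full Bayes posterior mean `θ̂_i = ∫ T_τ(X_i) π_{2n}(τ|X) dτ`. -/
def fbMean (a K : ℝ) (L : ℝ → ℝ) (π2 : ℝ → ℝ) (n : ℕ) (X : Fin n → ℝ) (i : Fin n) : ℝ :=
  ∫ τ in Set.Icc ((n:ℝ)⁻¹) 1, postMean a L τ (X i) * tauWeight a K L π2 ((n:ℝ)⁻¹) 1 n X τ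

/-- Full Bayes posterior variance `Var(θ_i | X)`. -/
def fbVar (a K : ℝ) (L : ℝ → ℝ) (π2 : ℝ → ℝ) (n : ℕ) (X : Fin n → ℝ) (i : Fin n) : ℝ :=
  (∫ τ in Set.Icc ((n:ℝ)⁻¹) 1,
      (postVar a L (X i) τ + (postMean a L τ (X i))^2) * tauWeight a K L π2 ((n:ℝ)⁻¹) 1 n X τ)
    - (fbMean a K L π2 n X i)^2

/-- The posterior distribution of `τ` given `X`, as a measure on `[lo, hi]`. -/
def tauPostMeasure (a K : ℝ) (L : ℝ → ℝ) (π2 : ℝ → ℝ) (lo hi : ℝ) (n : ℕ)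
    (X : Fin n → ℝ) : Measure ℝ :=
  (∫⁻ τ in Set.Icc lo hi, ENNReal.ofReal (π2 τ * ∏ i, marg a K L (X i) τ))⁻¹ •
    ((volume.restrict (Set.Icc lo hi)).withDensity
      fun τ => ENNReal.ofReal (π2 τ * ∏ i, marg a K L (X i) τ))

/-- The full Bayes posterior `Π(· | X)` of `θ` given `X`. -/
def PiFull (a K : ℝ) (L : ℝ → ℝ) (π2 : ℝ → ℝ) (n : ℕ) (X : Fin n → ℝ) :
    Measure (Fin n → ℝ) :=
  (tauPostMeasure a K L π2 ((n:ℝ)⁻¹) 1 n X).bind fun τ => PiTau a L n X τ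

/-- Condition (C1): `π_{2n}` is a density supported on `[1/n, 1]`. -/
def CondC1 (π2 : ℕ → ℝ → ℝ) : Prop :=
  (∀ (n : ℕ) (τ : ℝ), 0 ≤ π2 n τ) ∧ (∀ (n : ℕ) (τ : ℝ), τ ∉ Set.Icc ((n:ℝ)⁻¹) 1 → π2 n τ = 0) ∧
    ∀ n : ℕ, 1 ≤ n → ∫ τ in Set.Icc ((n:ℝ)⁻¹) 1, π2 n τ = 1

/-- `t_n = C_u π^{3/2} (q_n/n) √(log(n/q_n))`. -/
def tseq (Cu : ℝ) (q : ℕ → ℕ) (n : ℕ) : ℝ :=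
  Cu * Real.pi ^ ((3:ℝ)/2) * ((q n : ℝ)/n) * Real.sqrt (Real.log ((n:ℝ)/(q n)))

/-- Condition (C2). -/
def CondC2 (π2 : ℕ → ℝ → ℝ) (q : ℕ → ℕ) : Prop :=
  ∃ Cu c M1 K' : ℝ, 0 < Cu ∧ c ≤ Cu/2 ∧ 1 ≤ M1 ∧ 0 < K' ∧
    ∀ᶠ n : ℕ in atTop,
      K' * Real.exp (-c * q n) ≤
        ((q n : ℝ)/n)^M1 * ∫ τ in Set.Icc (tseq Cu q n / 2) (tseq Cu q n), π2 n τ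

/-- Full Bayes posterior shrinkage weight `E(1−κ_i | X)`. -/
def fbShrink (a K : ℝ) (L : ℝ → ℝ) (π2 : ℝ → ℝ) (lo hi : ℝ) (n : ℕ)
    (X : Fin n → ℝ) (i : Fin n) : ℝ :=
  ∫ τ in Set.Icc lo hi, E1mK a L (X i) τ * tauWeight a K L π2 lo hi n X τ

/-- Marginal two-groups distribution of one observation:
`(1−p) N(0,1) + p N(0, 1+ψ²)` with `u = ψ²`. -/
def mixM (p u : ℝ) : Measure ℝ :=
  ENNReal.ofReal (1 - p) • gaussianReal 0 1 +
    ENNReal.ofReal p • gaussianReal 0 (Real.toNNReal (1 + u))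

/-- Joint law of `X` given `ν_i = 0`. -/
def nullMeas (n : ℕ) (i : Fin n) (p u : ℝ) : Measure (Fin n → ℝ) :=
  Measure.pi fun j => if j = i then gaussianReal 0 1 else mixM p u

/-- Joint law of `X` given `ν_i = 1`. -/
def altMeas (n : ℕ) (i : Fin n) (p u : ℝ) : Measure (Fin n → ℝ) :=
  Measure.pi fun j => if j = i then gaussianReal 0 (Real.toNNReal (1 + u)) else mixM p u

/-- Type I error `t^{FB}_{1i}` of the full Bayes rule. -/
def t1FB (a K : ℝ) (L : ℝ → ℝ) (π2 : ℕ → ℝ → ℝ) (α : ℕ → ℝ) (p u : ℕ → ℝ)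
    (n : ℕ) (i : Fin n) : ℝ :=
  ((nullMeas n i (p n) (u n))
    {x | 1/2 < fbShrink a K L (π2 n) ((n:ℝ)⁻¹) (α n) n x i}).toReal

/-- Type II error `t^{FB}_{2i}` of the full Bayes rule. -/
def t2FB (a K : ℝ) (L : ℝ → ℝ) (π2 : ℕ → ℝ → ℝ) (α : ℕ → ℝ) (p u : ℕ → ℝ)
    (n : ℕ) (i : Fin n) : ℝ :=
  ((altMeas n i (p n) (u n))
    {x | fbShrink a K L (π2 n) ((n:ℝ)⁻¹) (α n) n x i ≤ 1/2}).toReal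

/-- Bayes risk `R^{FB}_{OG}` of the full Bayes rule. -/
def RFB (a K : ℝ) (L : ℝ → ℝ) (π2 : ℕ → ℝ → ℝ) (α : ℕ → ℝ) (p u : ℕ → ℝ) (n : ℕ) : ℝ :=
  ∑ i : Fin n, ((1 - p n) * t1FB a K L π2 α p u n i + p n * t2FB a K L π2 α p u n i)

/-- Condition (C3): `π_{2n}` is a density supported on `[1/n, α_n]`,
with `α_n → 0` and `n α_n → ∞`. -/
def CondC3 (π2 : ℕ → ℝ → ℝ) (α : ℕ → ℝ) : Prop :=
  (∀ (n : ℕ) (τ : ℝ), 0 ≤ π2 n τ) ∧ (∀ (n : ℕ) (τ : ℝ), τ ∉ Set.Icc ((n:ℝ)⁻¹) (α n) → π2 n τ = 0) ∧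
    (∀ n : ℕ, 1 ≤ n → ∫ τ in Set.Icc ((n:ℝ)⁻¹) (α n), π2 n τ = 1) ∧
    Tendsto α atTop (nhds 0) ∧ Tendsto (fun n : ℕ => (n:ℝ) * α n) atTop atTop

/-- Assumption 2 of Bogdan et al.: `p_n → 0`, `u_n = ψ_n² → ∞`,
`log v_n / u_n → C ∈ (0,∞)` with `v_n = u_n f_n²`, `f_n = (1-p_n)/p_n`. -/
def Assump2 (p u : ℕ → ℝ) (C : ℝ) : Prop :=
  Tendsto p atTop (nhds 0) ∧ Tendsto u atTop atTop ∧ 0 < C ∧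
    Tendsto (fun n => Real.log (u n * ((1 - p n)/p n)^2) / u n) atTop (nhds C)

/-- Standard normal cdf. -/
def Phi (z : ℝ) : ℝ := ((gaussianReal 0 1) (Set.Iic z)).toReal

/-- Squared threshold of the Bayes Oracle. -/
def csq (p u : ℕ → ℝ) (n : ℕ) : ℝ :=
  ((1 + u n)/u n) * (Real.log (1 + u n) + 2 * Real.log ((1 - p n)/p n))

/-- Type I error of the Bayes Oracle. -/
def t1BO (p u : ℕ → ℝ) (n : ℕ) : ℝ :=
  ((gaussianReal 0 1) {x : ℝ | csq p u n < x^2}).toReal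

/-- Type II error of the Bayes Oracle. -/
def t2BO (p u : ℕ → ℝ) (n : ℕ) : ℝ :=
  ((gaussianReal 0 (Real.toNNReal (1 + u n))) {x : ℝ | x^2 ≤ csq p u n}).toReal

/-- Bayes risk of the Bayes Oracle. -/
def RBO (p u : ℕ → ℝ) (n : ℕ) : ℝ :=
  (n:ℝ) * ((1 - p n) * t1BO p u n + p n * t2BO p u n)

end PaperGL

namespace PaperGL

lemma kdens_eq_mul_exp (a : ℝ) (L : ℝ → ℝ) (x τ κ : ℝ) :
    kdens a L x τ κ = kdens a L 0 τ κ * Real.exp ((1 - κ) * x^2 / 2) := by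
  simp [kdens]

lemma lintegral_Ioo_eq_lintegral_Ioi {τ : ℝ} (hτ : 0 < τ) (f : ℝ → ENNReal) :
    ∫⁻ κ in Ioo (0:ℝ) 1, f κ =
      ∫⁻ t in Ioi (0:ℝ), ENNReal.ofReal (τ^2 / (1 + t * τ^2)^2) * f (1 / (1 + t * τ^2)) := by
  have himg : (fun t : ℝ => 1 / (1 + t * τ^2)) '' Ioi (0:ℝ) = Ioo (0:ℝ) 1 := by
    ext κ
    constructor
    · rintro ⟨t, ht, rfl⟩
      have ht : 0 < t := ht
      have : 0 < t * τ^2 := by positivity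
      refine ⟨by positivity, ?_⟩
      rw [div_lt_one (by positivity)]
      linarith
    · rintro ⟨h0, h1⟩
      refine ⟨(1/κ - 1) / τ^2, ?_, ?_⟩
      · have : 1 < 1/κ := by rw [lt_div_iff₀ h0]; linarith
        have h2 : 0 < 1/κ - 1 := by linarith
        exact mem_Ioi.2 (by positivity)
      · have := hτ.ne'
        have := h0.ne'
        field_simp
        ring
  rw [← himg, lintegral_image_eq_lintegral_abs_deriv_mul (f' := fun t => -(τ^2) / (1 + t * τ^2)^2)
    measurableSet_Ioi]
  · refine setLIntegral_congr_fun measurableSet_Ioi fun t ht => ?_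
    have ht : 0 < t := ht
    rw [neg_div, abs_neg, abs_of_pos (by positivity)]
  · intro t ht
    have ht : 0 < t := ht
    have hne : (1 + t * τ^2) ≠ 0 := by positivity
    have h1 : HasDerivAt (fun t : ℝ => 1 + t * τ^2) (τ^2) t := by
      simpa using ((hasDerivAt_id t).mul_const (τ^2)).const_add 1
    simp only [one_div]
    exact (h1.inv hne).hasDerivWithinAt
  · intro t ht s hs hts
    have ht : 0 < t := ht
    have hs : 0 < s := hs
    simp only [one_div, inv_inj] at hts
    have : t * τ^2 = s * τ^2 := by linarith
    exact mul_right_cancel₀ (by positivity) this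

lemma kdens_param (a : ℝ) (L : ℝ → ℝ) {τ t : ℝ} (hτ : 0 < τ) (ht : 0 < t) :
    τ^2 / (1 + t * τ^2)^2 * kdens a L 0 τ (1 / (1 + t * τ^2)) =
      (τ^2)^(-a) * (t ^ (-a-1) * L t * (1 + t * τ^2) ^ (-(1:ℝ)/2)) := by
  have hw : 0 < 1 + t * τ^2 := by positivity
  have hs : 0 < τ^2 := by positivity
  have e1 : 1 - 1 / (1 + t * τ^2) = t * τ^2 / (1 + t * τ^2) := by field_simp; ring
  have e2 : (1/τ^2) * (1 / (1 / (1 + t * τ^2)) - 1) = t := by field_simp; ring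
  simp only [kdens]
  rw [e1, e2, one_div (1 + t * τ^2), Real.inv_rpow hw.le, Real.div_rpow (by positivity) hw.le,
    Real.mul_rpow ht.le hs.le]
  have e3 : (τ^2) ^ (-a) = (τ^2) * (τ^2) ^ (-a - 1) := by
    rw [show -a = 1 + (-a - 1) by ring, Real.rpow_add hs, Real.rpow_one]; ring_nf
  have e4 : (1 + t * τ^2) ^ (-(1:ℝ)/2) = ((1 + t * τ^2)^2)⁻¹ *
      ((1 + t * τ^2) ^ (a - 1/2))⁻¹ * ((1 + t * τ^2) ^ (-a-1))⁻¹ := by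
    rw [← Real.rpow_natCast (1 + t * τ^2), ← Real.rpow_neg hw.le, ← Real.rpow_neg hw.le, ← Real.rpow_neg hw.le,
      ← Real.rpow_add hw, ← Real.rpow_add hw]
    congr 1
    push_cast
    ring
  rw [e3, e4]
  simp
  field_simp

lemma measurable_kdens (a : ℝ) {L : ℝ → ℝ} (hL : Measurable L) (x τ : ℝ) :
    Measurable (kdens a L x τ) := by
  unfold kdens
  fun_prop

lemma kdens_pos (a : ℝ) {L : ℝ → ℝ} (hL : ∀ t, 0 < t → 0 < L t) (x : ℝ) {τ κ : ℝ} (hτ : 0 < τ)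
    (hκ : κ ∈ Ioo (0:ℝ) 1) : 0 < kdens a L x τ κ := by
  have h0 : 0 < κ := hκ.1
  have h1 : 0 < 1 - κ := by linarith [hκ.2]
  have h2 : 1 < 1/κ := by rw [lt_div_iff₀ h0]; linarith [hκ.2]
  have h3 : 0 < (1/τ^2) * (1/κ - 1) := mul_pos (by positivity) (by linarith)
  have := hL _ h3
  unfold kdens
  positivity

/-- The κ-integral of a function against the unnormalised prior, in the
`t`-parametrisation. -/
lemma lintegral_mul_kdens (a : ℝ) (L : ℝ → ℝ) {τ : ℝ} (hτ : 0 < τ) (g : ℝ → ℝ) :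
    ∫⁻ κ in Ioo (0:ℝ) 1, ENNReal.ofReal (g κ * kdens a L 0 τ κ) =
      ∫⁻ t in Ioi (0:ℝ), ENNReal.ofReal ((τ^2)^(-a) * (g (1 / (1 + t * τ^2)) *
        (t ^ (-a-1) * L t * (1 + t * τ^2) ^ (-(1:ℝ)/2)))) := by
  rw [lintegral_Ioo_eq_lintegral_Ioi hτ]
  refine setLIntegral_congr_fun measurableSet_Ioi fun t ht => ?_
  have ht : 0 < t := ht
  rw [← ENNReal.ofReal_mul (by positivity)]
  congr 1
  rw [mul_left_comm, kdens_param a L hτ ht]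
  ring

lemma lintegral_kdens_zero_le (a : ℝ) {L : ℝ → ℝ} (hL : ∀ t, 0 < t → 0 < L t)
    (hI : IntegrableOn (fun t => t ^ (-a-1) * L t) (Ioi (0:ℝ))) {τ : ℝ} (hτ : 0 < τ) :
    ∫⁻ κ in Ioo (0:ℝ) 1, ENNReal.ofReal (kdens a L 0 τ κ) ≤
      ENNReal.ofReal ((τ^2)^(-a) * ∫ t in Ioi (0:ℝ), t ^ (-a-1) * L t) := by
  have h := lintegral_mul_kdens a L hτ (fun _ => 1)
  simp only [one_mul] at h
  rw [h, ← integral_const_mul, ofReal_integral_eq_lintegral_ofReal (hI.const_mul _)]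
  · refine setLIntegral_mono' measurableSet_Ioi fun t ht => ENNReal.ofReal_le_ofReal ?_
    have ht : 0 < t := ht
    have hLt := hL t ht
    refine mul_le_mul_of_nonneg_left (mul_le_of_le_one_right (by positivity) ?_) (by positivity)
    refine Real.rpow_le_one_of_one_le_of_nonpos ?_ (by norm_num)
    have : 0 < t * τ^2 := by positivity
    linarith
  · refine (ae_restrict_iff' measurableSet_Ioi).2 (.of_forall fun t ht => ?_)
    have ht : 0 < t := ht
    have hLt := hL t ht
    simp only [Pi.zero_apply]
    positivity

/-- The unnormalised posterior mass is at least of order `τ ^ (-2a)`. -/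
lemma exists_le_lintegral_kdens (a : ℝ) {L : ℝ → ℝ} (hLm : Measurable L)
    (hL : ∀ t, 0 < t → 0 < L t)
    (hI : IntegrableOn (fun t => t ^ (-a-1) * L t) (Ioi (0:ℝ))) :
    ∃ c : ℝ, 0 < c ∧ ∀ τ : ℝ, 0 < τ → τ ≤ 1 → ∀ x : ℝ,
      ENNReal.ofReal (c * (τ^2)^(-a)) ≤
        ∫⁻ κ in Ioo (0:ℝ) 1, ENNReal.ofReal (kdens a L x τ κ) := by
  set c : ENNReal := ∫⁻ t in Ioi (0:ℝ),
    ENNReal.ofReal (t ^ (-a-1) * L t * (1 + t) ^ (-(1:ℝ)/2)) with hc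
  have hpos : ∀ t : ℝ, 0 < t → 0 < t ^ (-a-1) * L t * (1 + t) ^ (-(1:ℝ)/2) := fun t ht => by
    have := hL t ht
    positivity
  have hc0 : 0 < c := by
    rw [hc, setLIntegral_pos_iff (by fun_prop)]
    refine lt_of_lt_of_le ?_ (measure_mono (s := Ioi 0) fun t ht => ⟨?_, ht⟩)
    · simp
    · simpa using hpos t ht
  have hct : c ≠ ⊤ := by
    refine ne_top_of_le_ne_top (b := ∫⁻ t in Ioi (0:ℝ), ENNReal.ofReal (t ^ (-a-1) * L t)) ?_ ?_
    · exact hI.lintegral_lt_top.ne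
    · refine setLIntegral_mono' measurableSet_Ioi fun t ht => ENNReal.ofReal_le_ofReal ?_
      have ht : 0 < t := ht
      have hLt := hL t ht
      refine mul_le_of_le_one_right (by positivity) ?_
      exact Real.rpow_le_one_of_one_le_of_nonpos (by linarith) (by norm_num)
  refine ⟨c.toReal, ENNReal.toReal_pos hc0.ne' hct, fun τ hτ hτ1 x => ?_⟩
  calc ENNReal.ofReal (c.toReal * (τ^2)^(-a))
      = ENNReal.ofReal ((τ^2)^(-a)) * c := by
        rw [mul_comm, ENNReal.ofReal_mul (by positivity), ENNReal.ofReal_toReal hct]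
    _ = ∫⁻ t in Ioi (0:ℝ), ENNReal.ofReal ((τ^2)^(-a) *
          (t ^ (-a-1) * L t * (1 + t) ^ (-(1:ℝ)/2))) := by
        rw [hc, ← lintegral_const_mul _ (by fun_prop)]
        refine lintegral_congr fun t => ?_
        rw [ENNReal.ofReal_mul (p := (τ^2)^(-a)) (by positivity)]
    _ ≤ ∫⁻ κ in Ioo (0:ℝ) 1, ENNReal.ofReal (kdens a L 0 τ κ) := by
        have h := lintegral_mul_kdens a L hτ (fun _ => 1)
        simp only [one_mul] at h
        rw [h]
        refine setLIntegral_mono' measurableSet_Ioi fun t ht => ENNReal.ofReal_le_ofReal ?_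
        have ht : 0 < t := ht
        have hLt := hL t ht
        have h2 : τ^2 ≤ 1 := by nlinarith
        have h3 : t * τ^2 ≤ t := mul_le_of_le_one_right ht.le h2
        have h4 : (1 + t) ^ (-(1:ℝ)/2) ≤ (1 + t * τ^2) ^ (-(1:ℝ)/2) :=
          Real.rpow_le_rpow_of_nonpos (by positivity) (by linarith) (by norm_num)
        gcongr
    _ ≤ _ := by
        refine setLIntegral_mono' measurableSet_Ioo fun κ hκ => ENNReal.ofReal_le_ofReal ?_
        rw [kdens_eq_mul_exp a L x]
        refine le_mul_of_one_le_right (kdens_pos a hL 0 hτ hκ).le (Real.one_le_exp ?_)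
        have : 0 < 1 - κ := by linarith [hκ.2]
        positivity

lemma exists_lintegral_one_sub_mul_kdens_le {a : ℝ} (ha : 1/2 ≤ a) {L : ℝ → ℝ} {Mb : ℝ}
    (hL : ∀ t, 0 < t → 0 < L t) (hM : ∀ t, 0 < t → L t ≤ Mb)
    (hI : IntegrableOn (fun t => t ^ (-a-1) * L t) (Ioi (0:ℝ))) :
    ∃ C : ℝ, 0 < C ∧ ∀ τ : ℝ, 0 < τ → τ ≤ 1 →
      ∫⁻ κ in Ioo (0:ℝ) 1, ENNReal.ofReal ((1 - κ) * kdens a L 0 τ κ) ≤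
        ENNReal.ofReal (C * ((τ^2)^(-a) * τ)) := by
  set I := ∫ t in Ioi (0:ℝ), t ^ (-a-1) * L t with hIdef
  have hnn : ∀ t : ℝ, 0 < t → 0 ≤ t ^ (-a-1) * L t := fun t ht => by
    have := hL t ht
    positivity
  have hI0 : 0 ≤ I := setIntegral_nonneg measurableSet_Ioi fun t ht => hnn t ht
  have hMb : 0 < Mb := (hL 1 one_pos).trans_le (hM 1 one_pos)
  refine ⟨I + 4 * Mb, by positivity, fun τ hτ hτ1 => ?_⟩
  have hτ2 : 1 ≤ (τ^2)⁻¹ := by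
    rw [one_le_inv₀ (by positivity)]; nlinarith
  have hb : 0 < (τ^2)^(-a) := by positivity
  rw [lintegral_mul_kdens a L hτ (fun κ => 1 - κ)]
  have hs : ∀ t : ℝ, 0 < t → 1 - 1 / (1 + t * τ^2) ≤ t * τ^2 ∧ 1 - 1 / (1 + t * τ^2) ≤ 1 ∧
      0 ≤ 1 - 1 / (1 + t * τ^2) ∧ (1 + t * τ^2) ^ (-(1:ℝ)/2) ≤ 1 := fun t ht => by
    have h : 0 < t * τ^2 := by positivity
    have e1 : 1 - 1 / (1 + t * τ^2) = t * τ^2 / (1 + t * τ^2) := by field_simp; ring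
    refine ⟨?_, ?_, ?_, Real.rpow_le_one_of_one_le_of_nonpos (by linarith) (by norm_num)⟩
    · rw [e1]; exact div_le_self h.le (by linarith)
    · rw [e1, div_le_one (by positivity)]; linarith
    · rw [e1]; positivity
  have hdom : ∀ t : ℝ, 1 ≤ t → t ^ (-a-1) * L t ≤ Mb * t ^ (-(3:ℝ)/2) := fun t ht => by
    have h0 : 0 < t := by linarith
    have h1 : t ^ (-a-1) ≤ t ^ (-(3:ℝ)/2) := Real.rpow_le_rpow_of_exponent_le ht (by linarith)
    rw [mul_comm]
    exact mul_le_mul (hM t h0) h1 (by positivity) hMb.le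
  have hpt : ∀ t ∈ Ioi (0:ℝ), ENNReal.ofReal ((τ^2)^(-a) * ((1 - 1 / (1 + t * τ^2)) *
        (t ^ (-a-1) * L t * (1 + t * τ^2) ^ (-(1:ℝ)/2)))) ≤
      ENNReal.ofReal ((τ^2)^(-a) * τ * (t ^ (-a-1) * L t)) +
      ((Ioc 1 (τ^2)⁻¹).indicator
        (fun t => ENNReal.ofReal ((τ^2)^(-a) * Mb * τ^2 * t ^ (-(1:ℝ)/2))) t +
       (Ioi (τ^2)⁻¹).indicator
        (fun t => ENNReal.ofReal ((τ^2)^(-a) * Mb * t ^ (-(3:ℝ)/2))) t) := by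
    intro t ht
    have ht : 0 < t := ht
    obtain ⟨s1, s2, s3, s4⟩ := hs t ht
    have hw := hnn t ht
    have hw' : t ^ (-a-1) * L t * (1 + t * τ^2) ^ (-(1:ℝ)/2) ≤ t ^ (-a-1) * L t :=
      mul_le_of_le_one_right hw s4
    rcases le_or_gt t 1 with h1 | h1
    · refine le_trans (ENNReal.ofReal_le_ofReal ?_) le_self_add
      rw [mul_assoc _ τ]
      refine mul_le_mul_of_nonneg_left ?_ hb.le
      refine mul_le_mul (s1.trans ?_) hw' (by positivity) hτ.le
      nlinarith [sq_nonneg τ]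
    · refine le_trans ?_ le_add_self
      rcases le_or_gt t (τ^2)⁻¹ with h2 | h2
      · refine le_trans ?_ le_self_add
        rw [indicator_of_mem (show t ∈ Ioc 1 (τ^2)⁻¹ from ⟨h1, h2⟩)]
        refine ENNReal.ofReal_le_ofReal ?_
        have e : t ^ (-(1:ℝ)/2) = t * t ^ (-(3:ℝ)/2) := by
          rw [← Real.rpow_one_add' ht.le (by norm_num)]; norm_num
        rw [e, mul_assoc _ Mb, mul_assoc _ (Mb * τ^2)]
        refine mul_le_mul_of_nonneg_left ?_ hb.le
        calc _ ≤ (t * τ^2) * (Mb * t ^ (-(3:ℝ)/2)) :=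
              mul_le_mul s1 (hw'.trans (hdom t h1.le)) (by positivity) (by positivity)
          _ = _ := by ring
      · refine le_trans ?_ le_add_self
        rw [indicator_of_mem (show t ∈ Ioi (τ^2)⁻¹ from h2)]
        refine ENNReal.ofReal_le_ofReal ?_
        rw [mul_assoc _ Mb]
        refine mul_le_mul_of_nonneg_left ?_ hb.le
        calc _ ≤ 1 * (Mb * t ^ (-(3:ℝ)/2)) :=
              mul_le_mul s2 (hw'.trans (hdom t h1.le)) (by positivity) (by positivity)
          _ = _ := by ring
  refine (setLIntegral_mono' measurableSet_Ioi hpt).trans ?_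
  have hpow : ((τ^2)⁻¹) ^ (1/2 : ℝ) = τ⁻¹ := by
    rw [← Real.sqrt_eq_rpow, Real.sqrt_inv, Real.sqrt_sq hτ.le]
  have i1 : ∫⁻ t in Ioi (0:ℝ), ENNReal.ofReal ((τ^2)^(-a) * τ * (t ^ (-a-1) * L t)) ≤
      ENNReal.ofReal ((τ^2)^(-a) * τ * I) := by
    rw [hIdef, ← integral_const_mul, ofReal_integral_eq_lintegral_ofReal (hI.const_mul _)]
    refine (ae_restrict_iff' measurableSet_Ioi).2 (.of_forall fun t ht => ?_)
    have := hnn t ht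
    simp only [Pi.zero_apply]
    positivity
  have i2 : ∫⁻ t in Ioi (0:ℝ), (Ioc 1 (τ^2)⁻¹).indicator
      (fun t => ENNReal.ofReal ((τ^2)^(-a) * Mb * τ^2 * t ^ (-(1:ℝ)/2))) t ≤
      ENNReal.ofReal ((τ^2)^(-a) * τ * (2 * Mb)) := by
    rw [setLIntegral_indicator measurableSet_Ioc]
    refine (lintegral_mono_set inter_subset_left).trans ?_
    rw [← ofReal_integral_eq_lintegral_ofReal]
    · refine ENNReal.ofReal_le_ofReal ?_
      rw [integral_const_mul, ← intervalIntegral.integral_of_le hτ2,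
        integral_rpow (Or.inl (by norm_num))]
      rw [show -(1:ℝ)/2 + 1 = 1/2 by norm_num, hpow, Real.one_rpow]
      have : (τ^2) * τ⁻¹ = τ := by field_simp
      have h3 : (τ^2)^(-a) * Mb * τ^2 * ((τ⁻¹ - 1) / (1/2)) =
        (τ^2)^(-a) * τ * (2 * Mb) - 2 * ((τ^2)^(-a) * Mb * τ^2) := by
          linear_combination (2 * (τ^2)^(-a) * Mb) * this
      have h4 : 0 ≤ (τ^2)^(-a) * Mb * τ^2 := by positivity
      linarith
    · refine Integrable.const_mul ?_ _
      exact (intervalIntegrable_iff_integrableOn_Ioc_of_le hτ2).1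
        (intervalIntegral.intervalIntegrable_rpow' (by norm_num))
    · refine (ae_restrict_iff' measurableSet_Ioc).2 (.of_forall fun t ht => ?_)
      have : 0 < t := by linarith [ht.1]
      simp only [Pi.zero_apply]
      positivity
  have i3 : ∫⁻ t in Ioi (0:ℝ), (Ioi (τ^2)⁻¹).indicator
      (fun t => ENNReal.ofReal ((τ^2)^(-a) * Mb * t ^ (-(3:ℝ)/2))) t ≤
      ENNReal.ofReal ((τ^2)^(-a) * τ * (2 * Mb)) := by
    have hp : 0 < (τ^2)⁻¹ := by positivity
    rw [setLIntegral_indicator measurableSet_Ioi]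
    refine (lintegral_mono_set inter_subset_left).trans ?_
    rw [← ofReal_integral_eq_lintegral_ofReal]
    · refine ENNReal.ofReal_le_ofReal ?_
      rw [integral_const_mul, integral_Ioi_rpow_of_lt (by norm_num) hp]
      norm_num
      have : ((τ^2)⁻¹) ^ (-(1/2) : ℝ) = τ := by
        rw [Real.rpow_neg hp.le, hpow, inv_inv]
      norm_num at this
      rw [this]
      apply le_of_eq
      ring
    · exact (integrableOn_Ioi_rpow_of_lt (by norm_num) hp).const_mul _
    · refine (ae_restrict_iff' measurableSet_Ioi).2 (.of_forall fun t ht => ?_)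
      have : 0 < t := hp.trans ht
      simp only [Pi.zero_apply]
      positivity
  rw [lintegral_add_right, lintegral_add_right]
  · refine (add_le_add i1 (add_le_add i2 i3)).trans ?_
    rw [← ENNReal.ofReal_add (by positivity) (by positivity),
      ← ENNReal.ofReal_add (by positivity) (by positivity)]
    refine ENNReal.ofReal_le_ofReal (le_of_eq ?_)
    ring
  · exact Measurable.indicator (by fun_prop) measurableSet_Ioi
  · exact (Measurable.indicator (by fun_prop) measurableSet_Ioc).add
      (Measurable.indicator (by fun_prop) measurableSet_Ioi)

lemma exists_rpow_le_mul_exp {p ε : ℝ} (hp : 0 < p) (hε : 0 < ε) :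
    ∃ K : ℝ, 0 < K ∧ ∀ y : ℝ, 0 < y → y ^ p ≤ K * Real.exp (ε * y) := by
  refine ⟨(p / ε) ^ p, by positivity, fun y hy => ?_⟩
  have h1 : y ≤ (p / ε) * Real.exp (ε * y / p) := by
    have h := Real.add_one_le_exp (ε * y / p)
    calc y = (p / ε) * (ε * y / p) := by field_simp
      _ ≤ _ := by gcongr; linarith
  calc y ^ p ≤ ((p / ε) * Real.exp (ε * y / p)) ^ p := Real.rpow_le_rpow hy.le h1 hp.le
    _ = _ := by
      rw [Real.mul_rpow (by positivity) (by positivity), ← Real.exp_mul]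
      congr 2
      field_simp

lemma lintegral_exp_neg_mul_le {r : ℝ} (hr : 0 < r) :
    ∫⁻ κ in Ioo (0:ℝ) 1, ENNReal.ofReal (Real.exp (-r * κ)) ≤ ENNReal.ofReal (1 / r) := by
  refine (lintegral_mono_set (t := Ioi 0) fun κ hκ => hκ.1).trans ?_
  rw [← ofReal_integral_eq_lintegral_ofReal]
  · rw [integral_exp_mul_Ioi (by linarith)]
    simp
  · exact integrableOn_exp_mul_Ioi (by linarith) 0
  · exact .of_forall fun κ => (Real.exp_pos _).le

/-- Unnormalised posterior second moment around zero. -/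
lemma exists_lintegral_sq_mul_kdens_le {a : ℝ} (ha : 1/2 ≤ a) {L : ℝ → ℝ} {Mb : ℝ}
    (hLm : Measurable L) (hL : ∀ t, 0 < t → 0 < L t) (hM : ∀ t, 0 < t → L t ≤ Mb)
    (hI : IntegrableOn (fun t => t ^ (-a-1) * L t) (Ioi (0:ℝ))) :
    ∃ C : ℝ, 0 < C ∧ ∀ τ : ℝ, 0 < τ → τ ≤ 1 → ∀ x : ℝ,
      ∫⁻ κ in Ioo (0:ℝ) 1, ENNReal.ofReal (((1 - κ) + ((1 - κ) * x)^2) * kdens a L x τ κ) ≤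
        ENNReal.ofReal (C * ((τ^2)^(-a) * τ * Real.exp (x^2/2))) := by
  obtain ⟨C1, hC1, h1⟩ := exists_lintegral_one_sub_mul_kdens_le ha hL hM hI
  have hMb : 0 < Mb := (hL 1 one_pos).trans_le (hM 1 one_pos)
  refine ⟨2 * C1 + 2 * (2 ^ (a+1) * Mb), by positivity, fun τ hτ hτ1 x => ?_⟩
  have hpt : ∀ κ ∈ Ioo (0:ℝ) 1,
      ENNReal.ofReal (((1 - κ) + ((1 - κ) * x)^2) * kdens a L x τ κ) ≤
      ENNReal.ofReal (2 * Real.exp (x^2/2)) * ENNReal.ofReal ((1 - κ) * kdens a L 0 τ κ) +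
      ENNReal.ofReal (2 ^ (a+1) * Mb * x^2 * Real.exp (x^2/2)) *
        ENNReal.ofReal (Real.exp (-(x^2/2) * κ)) := by
    intro κ hκ
    have hs0 : 0 < 1 - κ := by linarith [hκ.2]
    have hk0 : 0 < kdens a L 0 τ κ := kdens_pos a hL 0 hτ hκ
    rw [← ENNReal.ofReal_mul (by positivity), ← ENNReal.ofReal_mul (by positivity),
      ← ENNReal.ofReal_add (by positivity) (by positivity)]
    refine ENNReal.ofReal_le_ofReal ?_
    rw [kdens_eq_mul_exp]
    rcases le_or_gt (1 - κ) (1/2) with hs | hs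
    · refine le_add_of_le_of_nonneg ?_ (by positivity)
      have e1 : 1 + (1 - κ) * x^2 ≤ 2 * Real.exp ((1 - κ) * x^2 / 2) := by
        have := Real.add_one_le_exp ((1 - κ) * x^2 / 2)
        linarith
      have e2 : Real.exp ((1 - κ) * x^2 / 2) * Real.exp ((1 - κ) * x^2 / 2) ≤
          Real.exp (x^2/2) := by
        rw [← Real.exp_add]
        refine Real.exp_le_exp.2 ?_
        nlinarith [sq_nonneg x]
      calc _ = (1 - κ) * kdens a L 0 τ κ *
            ((1 + (1 - κ) * x^2) * Real.exp ((1 - κ) * x^2 / 2)) := by ring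
        _ ≤ (1 - κ) * kdens a L 0 τ κ *
            ((2 * Real.exp ((1 - κ) * x^2 / 2)) * Real.exp ((1 - κ) * x^2 / 2)) := by gcongr
        _ = 2 * ((1 - κ) * kdens a L 0 τ κ) *
            (Real.exp ((1 - κ) * x^2 / 2) * Real.exp ((1 - κ) * x^2 / 2)) := by ring
        _ ≤ 2 * ((1 - κ) * kdens a L 0 τ κ) * Real.exp (x^2/2) := by gcongr
        _ = _ := by ring
    · have e1 : Real.exp ((1 - κ) * x^2 / 2) ≤ Real.exp (x^2/2) := by
        refine Real.exp_le_exp.2 ?_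
        nlinarith [sq_nonneg x, hκ.1]
      have e3 : Real.exp ((1 - κ) * x^2 / 2) = Real.exp (x^2/2) * Real.exp (-(x^2/2) * κ) := by
        rw [← Real.exp_add]; congr 1; ring
      have e2 : (1 - κ)^2 * kdens a L 0 τ κ ≤ 2 ^ (a+1) * Mb := by
        have t1 : κ ^ (a - 1/2) ≤ 1 := Real.rpow_le_one hκ.1.le hκ.2.le (by linarith)
        have t2 : (1 - κ) ^ (-a-1) ≤ 2 ^ (a+1) := by
          calc (1 - κ) ^ (-a-1) ≤ (1/2) ^ (-a-1) :=
                Real.rpow_le_rpow_of_nonpos (by norm_num) hs.le (by linarith)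
            _ = 2 ^ (a+1) := by
                rw [one_div, Real.inv_rpow (by norm_num), ← Real.rpow_neg (by norm_num)]
                congr 1; ring
        have h3 : 0 < (1/τ^2) * (1/κ - 1) := by
          have h2 : 1 < 1/κ := by rw [lt_div_iff₀ hκ.1]; linarith [hκ.2]
          exact mul_pos (by positivity) (by linarith)
        have t3 := hM _ h3
        have t4 := hL _ h3
        have t5 : kdens a L 0 τ κ ≤ 1 * 2 ^ (a+1) * Mb := by
          simp only [kdens]
          norm_num
          norm_num at t1 t3 t4
          have := Real.rpow_nonneg hκ.1.le (a - 1/2)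
          norm_num at this
          have h9 := mul_le_mul t1 t2 (by positivity) zero_le_one
          have := mul_le_mul h9 t3 t4.le (by positivity)
          simpa using this
        have t6 : (1 - κ)^2 ≤ 1 := by nlinarith [hκ.1]
        calc _ ≤ 1 * (1 * 2 ^ (a+1) * Mb) := mul_le_mul t6 t5 hk0.le zero_le_one
          _ = _ := by ring
      calc _ = (1 - κ) * kdens a L 0 τ κ * Real.exp ((1 - κ) * x^2 / 2) +
            ((1 - κ)^2 * kdens a L 0 τ κ) * x^2 * Real.exp ((1 - κ) * x^2 / 2) := by ring
        _ ≤ (1 - κ) * kdens a L 0 τ κ * (2 * Real.exp (x^2/2)) +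
            (2 ^ (a+1) * Mb) * x^2 * Real.exp ((1 - κ) * x^2 / 2) := by
            gcongr
            linarith [Real.exp_pos (x^2/2)]
        _ = _ := by rw [e3]; ring
  refine (setLIntegral_mono' measurableSet_Ioo hpt).trans ?_
  have hk := measurable_kdens a hLm 0 τ
  rw [lintegral_add_right _ (by fun_prop), lintegral_const_mul _ (by fun_prop),
    lintegral_const_mul _ (by fun_prop)]
  have i2 : ENNReal.ofReal (2 ^ (a+1) * Mb * x^2 * Real.exp (x^2/2)) *
      ∫⁻ κ in Ioo (0:ℝ) 1, ENNReal.ofReal (Real.exp (-(x^2/2) * κ)) ≤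
      ENNReal.ofReal (2 * (2 ^ (a+1) * Mb) * Real.exp (x^2/2)) := by
    rcases eq_or_ne x 0 with rfl | hx
    · simp
    · have hx2 : 0 < x^2 := by positivity
      calc _ ≤ ENNReal.ofReal (2 ^ (a+1) * Mb * x^2 * Real.exp (x^2/2)) *
            ENNReal.ofReal (1 / (x^2/2)) := by
            gcongr
            exact lintegral_exp_neg_mul_le (by positivity)
        _ = _ := by
            rw [← ENNReal.ofReal_mul (by positivity)]
            congr 1
            field_simp
  have hone : 1 ≤ (τ^2)^(-a) * τ := by
    have : (τ^2) ^ (-(1/2:ℝ)) ≤ (τ^2) ^ (-a) :=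
      Real.rpow_le_rpow_of_exponent_ge (by positivity) (by nlinarith) (by linarith)
    rw [Real.rpow_neg (by positivity), ← Real.sqrt_eq_rpow, Real.sqrt_sq hτ.le] at this
    calc 1 = τ⁻¹ * τ := by field_simp
      _ ≤ _ := by gcongr
  calc _ ≤ ENNReal.ofReal (2 * Real.exp (x^2/2)) * ENNReal.ofReal (C1 * ((τ^2)^(-a) * τ)) +
        ENNReal.ofReal (2 * (2 ^ (a+1) * Mb) * Real.exp (x^2/2)) := by
        gcongr
        exact h1 τ hτ hτ1
    _ ≤ _ := by
        rw [← ENNReal.ofReal_mul (by positivity), ← ENNReal.ofReal_add (by positivity)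
          (by positivity)]
        refine ENNReal.ofReal_le_ofReal ?_
        have : 2 * (2 ^ (a+1) * Mb) * Real.exp (x^2/2) * 1 ≤
          2 * (2 ^ (a+1) * Mb) * Real.exp (x^2/2) * ((τ^2)^(-a) * τ) := by gcongr
        linarith

/-- For large observations the unnormalised posterior mass is at least of order
`exp (x²/2) |x| ^ (-2a-1)`. -/
lemma exists_exp_le_lintegral_kdens {a : ℝ} (ha : 1/2 ≤ a) {L : ℝ → ℝ} {c0 t0 : ℝ}
    (hc0 : 0 < c0) (ht0 : 0 < t0) (hA : ∀ t, t0 ≤ t → c0 ≤ L t) :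
    ∃ c : ℝ, 0 < c ∧ ∀ τ : ℝ, 0 < τ → τ ≤ 1 → ∀ x : ℝ, 1 + t0 ≤ x^2 →
      ENNReal.ofReal (c * (Real.exp (x^2/2) * (x^2) ^ (-(a + 1/2)))) ≤
        ∫⁻ κ in Ioo (0:ℝ) 1, ENNReal.ofReal (kdens a L x τ κ) := by
  refine ⟨c0 * Real.exp (-1/2) * 2 ^ (-(a + 1/2)), by positivity, fun τ hτ hτ1 x hx => ?_⟩
  set y := x^2 with hy
  have hy0 : 0 < y := by linarith
  have hy1 : 1/y < 1 := by rw [div_lt_one hy0]; linarith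
  have hsub : Ioo (1/(2*y)) (1/y) ⊆ Ioo (0:ℝ) 1 := fun κ hκ =>
    ⟨lt_trans (by positivity) hκ.1, hκ.2.trans hy1⟩
  calc _ = ENNReal.ofReal (c0 * Real.exp (-1/2) * (2*y) ^ (-(a - 1/2)) * Real.exp (y/2)) *
        volume (Ioo (1/(2*y)) (1/y)) := by
        rw [Real.volume_Ioo, ← ENNReal.ofReal_mul (by positivity)]
        congr 1
        have e1 : 1/y - 1/(2*y) = (2*y) ^ (-1 : ℝ) := by
          rw [Real.rpow_neg_one]; field_simp; ring
        rw [e1]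
        have e2 : (2:ℝ) ^ (-(a + 1/2)) * y ^ (-(a + 1/2)) =
            (2*y) ^ (-(a - 1/2)) * (2*y) ^ (-1 : ℝ) := by
          rw [← Real.mul_rpow (by norm_num) hy0.le, ← Real.rpow_add (by positivity)]
          congr 1; ring
        linear_combination (c0 * Real.exp (-1/2) * Real.exp (y/2)) * e2
    _ = ∫⁻ κ in Ioo (1/(2*y)) (1/y),
        ENNReal.ofReal (c0 * Real.exp (-1/2) * (2*y) ^ (-(a - 1/2)) * Real.exp (y/2)) := by
        rw [setLIntegral_const]
    _ ≤ ∫⁻ κ in Ioo (1/(2*y)) (1/y), ENNReal.ofReal (kdens a L x τ κ) := by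
        refine setLIntegral_mono' measurableSet_Ioo fun κ hκ => ENNReal.ofReal_le_ofReal ?_
        have hκ' := hsub hκ
        have hs0 : 0 < 1 - κ := by linarith [hκ'.2]
        have t1 : (2*y) ^ (-(a - 1/2)) ≤ κ ^ (a - 1/2) := by
          rw [Real.rpow_neg (by positivity), ← Real.inv_rpow (by positivity), ← one_div]
          exact Real.rpow_le_rpow (by positivity) hκ.1.le (by linarith)
        have t2 : 1 ≤ (1 - κ) ^ (-a-1) :=
          Real.one_le_rpow_of_pos_of_le_one_of_nonpos hs0 (by linarith [hκ'.1]) (by linarith)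
        have t3 : c0 ≤ L ((1/τ^2) * (1/κ - 1)) := by
          refine hA _ ?_
          have h1 : y ≤ 1/κ := by
            rw [le_div_iff₀ hκ'.1]
            have := (lt_div_iff₀ hy0).1 hκ.2
            linarith
          have h2 : 1 ≤ 1/τ^2 := by rw [le_div_iff₀ (by positivity)]; nlinarith
          nlinarith
        have t4 : Real.exp (-1/2) * Real.exp (y/2) ≤ Real.exp ((1 - κ) * x^2 / 2) := by
          rw [← Real.exp_add]
          refine Real.exp_le_exp.2 ?_
          have := (lt_div_iff₀ hy0).1 hκ.2
          rw [← hy]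
          linarith
        unfold kdens
        have h0 : 0 ≤ κ ^ (a - 1/2) := Real.rpow_nonneg hκ'.1.le _
        have hL0 : 0 < L ((1/τ^2) * (1/κ - 1)) := hc0.trans_le t3
        calc _ = (2*y) ^ (-(a - 1/2)) * 1 * c0 * (Real.exp (-1/2) * Real.exp (y/2)) := by ring
          _ ≤ _ := by gcongr
    _ ≤ _ := lintegral_mono_set hsub

/-- Unnormalised posterior second moment of `κ x`, compared to the normalising constant. -/
lemma exists_lintegral_mul_kappa_sq_mul_kdens_le {a : ℝ} (ha : 1/2 ≤ a) {L : ℝ → ℝ}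
    {Mb c0 t0 : ℝ} (hLm : Measurable L) (hL : ∀ t, 0 < t → 0 < L t)
    (hM : ∀ t, 0 < t → L t ≤ Mb)
    (hc0 : 0 < c0) (ht0 : 0 < t0) (hA : ∀ t, t0 ≤ t → c0 ≤ L t)
    (hI : IntegrableOn (fun t => t ^ (-a-1) * L t) (Ioi (0:ℝ))) :
    ∃ C : ℝ, 0 < C ∧ ∀ τ : ℝ, 0 < τ → τ ≤ 1 → ∀ x : ℝ,
      ∫⁻ κ in Ioo (0:ℝ) 1, ENNReal.ofReal ((κ * x)^2 * kdens a L x τ κ) ≤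
        ENNReal.ofReal (C * (1 - Real.log τ)) *
          ∫⁻ κ in Ioo (0:ℝ) 1, ENNReal.ofReal (kdens a L x τ κ) := by
  have hMb : 0 < Mb := (hL 1 one_pos).trans_le (hM 1 one_pos)
  set I := ∫ t in Ioi (0:ℝ), t ^ (-a-1) * L t with hIdef
  have hI0 : 0 ≤ I := setIntegral_nonneg measurableSet_Ioi fun t ht => by
    have ht : 0 < t := ht
    have := hL t ht
    positivity
  obtain ⟨c, hc, hD⟩ := exists_exp_le_lintegral_kdens ha hc0 ht0 hA
  set k0 : ℝ := 1 / (1 + t0) with hk0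
  have hk0p : 0 < k0 := by positivity
  have hk01 : k0 < 1 := by rw [hk0, div_lt_one (by positivity)]; linarith
  obtain ⟨K1, hK1, hE1⟩ := exists_rpow_le_mul_exp (p := a + 1/2) (ε := 1/4) (by linarith)
    (by norm_num)
  obtain ⟨K2, hK2, hE2⟩ := exists_rpow_le_mul_exp (p := a + 3/2) (ε := k0/4) (by linarith)
    (by positivity)
  set A : ℝ := Mb * (1 - k0) ^ (-a-1) * K1 with hAdef
  have h1k0 : 0 < 1 - k0 := by linarith
  have hApos : 0 < A := by positivity
  set B : ℝ := (1 + t0) + 8 * a / k0 with hB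
  have hBpos : 0 < B := by positivity
  refine ⟨B + (4 * A + K2 * I) / c, by positivity, fun τ hτ hτ1 x => ?_⟩
  have hlog : Real.log τ ≤ 0 := Real.log_nonpos hτ.le hτ1
  set y := x^2 with hy
  rcases le_or_gt y (B * (1 - Real.log τ)) with hyB | hyB
  · have hk := measurable_kdens a hLm x τ
    rw [← lintegral_const_mul _ (by fun_prop)]
    refine setLIntegral_mono' measurableSet_Ioo fun κ hκ => ?_
    rw [← ENNReal.ofReal_mul (by
      have : 0 ≤ 1 - Real.log τ := by linarith
      positivity)]
    refine ENNReal.ofReal_le_ofReal ?_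
    refine mul_le_mul_of_nonneg_right ?_ (kdens_pos a hL x hτ hκ).le
    have h1 : (κ * x)^2 ≤ y := by
      rw [mul_pow]
      refine mul_le_of_le_one_left (sq_nonneg x) ?_
      nlinarith [hκ.1, hκ.2]
    refine h1.trans (hyB.trans ?_)
    refine mul_le_mul_of_nonneg_right ?_ (by linarith)
    have : 0 ≤ (4 * A + K2 * I) / c := by positivity
    linarith
  · have hyB1 : B ≤ y := by nlinarith
    have hyt : 1 + t0 ≤ y := by
      have : 0 ≤ 8 * a / k0 := by positivity
      linarith
    have hy0 : 0 < y := by linarith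
    have hyτ : 2 * a * (-Real.log τ) ≤ k0 / 4 * y := by
      have h1 : 8 * a / k0 * (-Real.log τ) ≤ y := by
        have : 8 * a / k0 ≤ B := by linarith
        nlinarith
      calc 2 * a * (-Real.log τ) = k0/4 * (8 * a / k0 * (-Real.log τ)) := by field_simp; ring
        _ ≤ _ := by gcongr
    have hτa : (τ^2)^(-a) ≤ Real.exp (k0/4 * y) := by
      rw [← Real.rpow_natCast, ← Real.rpow_mul hτ.le, Real.rpow_def_of_pos hτ]
      refine Real.exp_le_exp.2 ?_
      push_cast
      linarith
    have hpt : ∀ κ ∈ Ioo (0:ℝ) 1, ENNReal.ofReal ((κ * x)^2 * kdens a L x τ κ) ≤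
        ENNReal.ofReal (A * Real.exp (y/2) * y ^ (-(a + 1/2)) * y) *
          ENNReal.ofReal (Real.exp (-(y/4) * κ)) +
        ENNReal.ofReal (y * Real.exp (y/2) * Real.exp (-(k0/2) * y)) *
          ENNReal.ofReal (kdens a L 0 τ κ) := by
      intro κ hκ
      have hκ0 : 0 < κ := hκ.1
      have hs0 : 0 < 1 - κ := by linarith [hκ.2]
      have hkp : 0 < kdens a L 0 τ κ := kdens_pos a hL 0 hτ hκ
      rw [← ENNReal.ofReal_mul (by positivity), ← ENNReal.ofReal_mul (by positivity),
        ← ENNReal.ofReal_add (by positivity) (by positivity)]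
      refine ENNReal.ofReal_le_ofReal ?_
      rw [kdens_eq_mul_exp]
      have e3 : Real.exp ((1 - κ) * x^2 / 2) =
          Real.exp (y/2) * (Real.exp (-(y/4) * κ) * Real.exp (-(y/4) * κ)) := by
        rw [← Real.exp_add, ← Real.exp_add]; congr 1; rw [hy]; ring
      rcases le_or_gt κ k0 with hs | hs
      · refine le_add_of_le_of_nonneg ?_ (by positivity)
        have t2 : (1 - κ) ^ (-a-1) ≤ (1 - k0) ^ (-a-1) :=
          Real.rpow_le_rpow_of_nonpos h1k0 (by linarith) (by linarith)
        have h3 : 0 < (1/τ^2) * (1/κ - 1) := by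
          have h2 : 1 < 1/κ := by rw [lt_div_iff₀ hκ.1]; linarith [hκ.2]
          exact mul_pos (by positivity) (by linarith)
        have t3 := hM _ h3
        have t4 := hL _ h3
        have t5 : kdens a L 0 τ κ ≤ κ ^ (a - 1/2) * (1 - k0) ^ (-a-1) * Mb := by
          have : kdens a L 0 τ κ = κ ^ (a - 1/2) * (1 - κ) ^ (-a-1) *
              L ((1/τ^2) * (1/κ - 1)) := by simp [kdens]
          rw [this]
          gcongr
        have t6 : κ^2 * κ ^ (a - 1/2) ≤ κ ^ (a + 1/2) := by
          rw [← Real.rpow_natCast, ← Real.rpow_add hκ0]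
          exact Real.rpow_le_rpow_of_exponent_ge hκ0 hκ.2.le (by push_cast; linarith)
        have t7 : κ ^ (a + 1/2) * Real.exp (-(y/4) * κ) ≤ K1 * y ^ (-(a + 1/2)) := by
          have := hE1 (κ * y) (by positivity)
          rw [Real.mul_rpow hκ0.le hy0.le] at this
          have h8 : Real.exp (1/4 * (κ * y)) * Real.exp (-(y/4) * κ) = 1 := by
            rw [← Real.exp_add]; ring_nf; exact Real.exp_zero
          have h9 : y ^ (a + 1/2) * y ^ (-(a + 1/2)) = 1 := by
            rw [← Real.rpow_add hy0]; simp
          calc _ = (κ ^ (a + 1/2) * y ^ (a + 1/2)) *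
                (Real.exp (-(y/4) * κ) * y ^ (-(a + 1/2))) := by
                linear_combination (-(κ ^ (a + 1/2) * Real.exp (-(y/4) * κ))) * h9
            _ ≤ (K1 * Real.exp (1/4 * (κ * y))) *
                (Real.exp (-(y/4) * κ) * y ^ (-(a + 1/2))) := by gcongr
            _ = _ := by linear_combination (K1 * y ^ (-(a + 1/2))) * h8
        calc _ = y * κ^2 * kdens a L 0 τ κ * (Real.exp (y/2) *
              (Real.exp (-(y/4) * κ) * Real.exp (-(y/4) * κ))) := by rw [e3, hy]; ring
          _ ≤ y * κ^2 * (κ ^ (a - 1/2) * (1 - k0) ^ (-a-1) * Mb) * (Real.exp (y/2) *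
              (Real.exp (-(y/4) * κ) * Real.exp (-(y/4) * κ))) := by gcongr
          _ = (y * (1 - k0) ^ (-a-1) * Mb * Real.exp (y/2) * Real.exp (-(y/4) * κ)) *
              ((κ^2 * κ ^ (a - 1/2)) * Real.exp (-(y/4) * κ)) := by ring
          _ ≤ (y * (1 - k0) ^ (-a-1) * Mb * Real.exp (y/2) * Real.exp (-(y/4) * κ)) *
              (κ ^ (a + 1/2) * Real.exp (-(y/4) * κ)) := by gcongr
          _ ≤ (y * (1 - k0) ^ (-a-1) * Mb * Real.exp (y/2) * Real.exp (-(y/4) * κ)) *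
              (K1 * y ^ (-(a + 1/2))) := by gcongr
          _ = _ := by rw [hAdef]; ring
      · refine le_add_of_nonneg_of_le (by positivity) ?_
        have e1 : Real.exp ((1 - κ) * x^2 / 2) ≤ Real.exp (y/2) * Real.exp (-(k0/2) * y) := by
          rw [← Real.exp_add, ← hy]
          refine Real.exp_le_exp.2 ?_
          nlinarith
        have e2 : κ^2 ≤ 1 := by nlinarith [hκ.2]
        calc _ = κ^2 * (y * kdens a L 0 τ κ) * Real.exp ((1 - κ) * x^2 / 2) := by rw [hy]; ring
          _ ≤ 1 * (y * kdens a L 0 τ κ) * (Real.exp (y/2) * Real.exp (-(k0/2) * y)) := by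
            gcongr
          _ = _ := by ring
    refine (setLIntegral_mono' measurableSet_Ioo hpt).trans ?_
    have hk := measurable_kdens a hLm 0 τ
    rw [lintegral_add_right _ (by fun_prop), lintegral_const_mul _ (by fun_prop),
      lintegral_const_mul _ (by fun_prop)]
    have hfin : y * Real.exp (-(k0/4) * y) ≤ K2 * y ^ (-(a + 1/2)) := by
      have h := hE2 y hy0
      have h8 : Real.exp (k0/4 * y) * Real.exp (-(k0/4) * y) = 1 := by
        rw [← Real.exp_add]; ring_nf; exact Real.exp_zero
      have h9 : y ^ (a + 3/2) * y ^ (-(a + 1/2)) = y := by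
        rw [← Real.rpow_add hy0]; ring_nf; exact Real.rpow_one y
      calc _ = y ^ (a + 3/2) * (y ^ (-(a + 1/2)) * Real.exp (-(k0/4) * y)) := by
            linear_combination (-Real.exp (-(k0/4) * y)) * h9
        _ ≤ (K2 * Real.exp (k0/4 * y)) * (y ^ (-(a + 1/2)) * Real.exp (-(k0/4) * y)) := by
            gcongr
        _ = _ := by linear_combination (K2 * y ^ (-(a + 1/2))) * h8
    calc _ ≤ ENNReal.ofReal (A * Real.exp (y/2) * y ^ (-(a + 1/2)) * y) *
          ENNReal.ofReal (1 / (y/4)) +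
          ENNReal.ofReal (y * Real.exp (y/2) * Real.exp (-(k0/2) * y)) *
          ENNReal.ofReal ((τ^2)^(-a) * I) := by
          gcongr
          · exact lintegral_exp_neg_mul_le (by positivity)
          · exact lintegral_kdens_zero_le a hL hI hτ
      _ ≤ ENNReal.ofReal ((4 * A + K2 * I) / c) *
          ENNReal.ofReal (c * (Real.exp (y/2) * y ^ (-(a + 1/2)))) := by
          rw [← ENNReal.ofReal_mul (by positivity), ← ENNReal.ofReal_mul (by positivity),
            ← ENNReal.ofReal_add (by positivity) (by positivity),
            ← ENNReal.ofReal_mul (by positivity)]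
          refine ENNReal.ofReal_le_ofReal ?_
          have u1 : A * Real.exp (y/2) * y ^ (-(a + 1/2)) * y * (1 / (y/4)) =
            4 * A * (Real.exp (y/2) * y ^ (-(a + 1/2))) := by field_simp
          have u2 : (4 * A + K2 * I) / c * (c * (Real.exp (y/2) * y ^ (-(a + 1/2)))) =
            4 * A * (Real.exp (y/2) * y ^ (-(a + 1/2))) +
              Real.exp (y/2) * I * (K2 * y ^ (-(a + 1/2))) := by
            field_simp
          have u3 : Real.exp (-(k0/2) * y) =
              Real.exp (-(k0/4) * y) * Real.exp (-(k0/4) * y) := by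
            rw [← Real.exp_add]; congr 1; ring
          have h8 : Real.exp (k0/4 * y) * Real.exp (-(k0/4) * y) = 1 := by
            rw [← Real.exp_add]; ring_nf; exact Real.exp_zero
          have u4 : y * Real.exp (y/2) * Real.exp (-(k0/2) * y) * ((τ^2)^(-a) * I) ≤
              Real.exp (y/2) * I * (K2 * y ^ (-(a + 1/2))) := by
            calc _ ≤ y * Real.exp (y/2) * Real.exp (-(k0/2) * y) *
                  (Real.exp (k0/4 * y) * I) := by gcongr
              _ = Real.exp (y/2) * I * (y * Real.exp (-(k0/4) * y)) := by
                  rw [u3]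
                  linear_combination
                    (y * Real.exp (y/2) * Real.exp (-(k0/4) * y) * I) * h8
              _ ≤ _ := by gcongr
          rw [u1, u2]
          linarith
      _ ≤ _ := by
          refine mul_le_mul' (ENNReal.ofReal_le_ofReal ?_) (hD τ hτ hτ1 x hyt)
          have h1 : (0:ℝ) ≤ (4 * A + K2 * I) / c := by positivity
          nlinarith

lemma lintegral_kdens_ne_zero (a : ℝ) {L : ℝ → ℝ} (hLm : Measurable L)
    (hL : ∀ t, 0 < t → 0 < L t) (x : ℝ) {τ : ℝ} (hτ : 0 < τ) :
    ∫⁻ κ in Ioo (0:ℝ) 1, ENNReal.ofReal (kdens a L x τ κ) ≠ 0 := by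
  have hk := measurable_kdens a hLm x τ
  refine ne_of_gt ?_
  rw [setLIntegral_pos_iff (by fun_prop)]
  refine lt_of_lt_of_le ?_ (measure_mono (s := Ioo 0 1) fun κ hκ => ⟨?_, hκ⟩)
  · simp
  · simpa using kdens_pos a hL x hτ hκ

lemma lintegral_kdens_ne_top (a : ℝ) {L : ℝ → ℝ} (hLm : Measurable L)
    (hL : ∀ t, 0 < t → 0 < L t)
    (hI : IntegrableOn (fun t => t ^ (-a-1) * L t) (Ioi (0:ℝ))) (x : ℝ) {τ : ℝ} (hτ : 0 < τ) :
    ∫⁻ κ in Ioo (0:ℝ) 1, ENNReal.ofReal (kdens a L x τ κ) ≠ ⊤ := by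
  have hk := measurable_kdens a hLm 0 τ
  have h : ∫⁻ κ in Ioo (0:ℝ) 1, ENNReal.ofReal (kdens a L x τ κ) ≤
      ENNReal.ofReal (Real.exp (x^2/2)) *
        ∫⁻ κ in Ioo (0:ℝ) 1, ENNReal.ofReal (kdens a L 0 τ κ) := by
    rw [← lintegral_const_mul _ (by fun_prop)]
    refine setLIntegral_mono' measurableSet_Ioo fun κ hκ => ?_
    rw [← ENNReal.ofReal_mul (by positivity), kdens_eq_mul_exp, mul_comm]
    refine ENNReal.ofReal_le_ofReal (mul_le_mul_of_nonneg_right ?_ (kdens_pos a hL 0 hτ hκ).le)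
    refine Real.exp_le_exp.2 ?_
    nlinarith [hκ.1, sq_nonneg x]
  refine ne_top_of_le_ne_top (ENNReal.mul_ne_top ENNReal.ofReal_ne_top ?_) h
  exact ne_top_of_le_ne_top ENNReal.ofReal_ne_top (lintegral_kdens_zero_le a hL hI hτ)

lemma lintegral_kPostMeasure (a : ℝ) {L : ℝ → ℝ} (hLm : Measurable L) (x τ : ℝ)
    {f : ℝ → ENNReal} (hf : Measurable f) :
    ∫⁻ κ, f κ ∂kPostMeasure a L x τ =
      (∫⁻ κ in Ioo (0:ℝ) 1, ENNReal.ofReal (kdens a L x τ κ))⁻¹ *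
        ∫⁻ κ in Ioo (0:ℝ) 1, ENNReal.ofReal (kdens a L x τ κ) * f κ := by
  have hk := measurable_kdens a hLm x τ
  rw [kPostMeasure, lintegral_smul_measure,
    lintegral_withDensity_eq_lintegral_mul _ (by fun_prop) hf]
  rfl

lemma isProbabilityMeasure_kPostMeasure (a : ℝ) {L : ℝ → ℝ} (hLm : Measurable L)
    (hL : ∀ t, 0 < t → 0 < L t)
    (hI : IntegrableOn (fun t => t ^ (-a-1) * L t) (Ioi (0:ℝ))) (x : ℝ) {τ : ℝ} (hτ : 0 < τ) :
    IsProbabilityMeasure (kPostMeasure a L x τ) := by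
  constructor
  have h := lintegral_kPostMeasure a hLm x τ (f := fun _ => 1) measurable_const
  simp only [lintegral_one, mul_one] at h
  rw [h]
  exact ENNReal.inv_mul_cancel (lintegral_kdens_ne_zero a hLm hL x hτ)
    (lintegral_kdens_ne_top a hLm hL hI x hτ)

lemma ae_kPostMeasure_mem_Ioo (a : ℝ) (L : ℝ → ℝ) (x τ : ℝ) :
    ∀ᵐ κ ∂kPostMeasure a L x τ, κ ∈ Ioo (0:ℝ) 1 :=
  Measure.ae_smul_measure ((withDensity_absolutelyContinuous _ _).ae_le
    (ae_restrict_mem measurableSet_Ioo)) _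

lemma E1mK_eq_integral (a : ℝ) {L : ℝ → ℝ} (hLm : Measurable L) (hL : ∀ t, 0 < t → 0 < L t)
    (x : ℝ) {τ : ℝ} (hτ : 0 < τ) :
    E1mK a L x τ = ∫ κ, (1 - κ) ∂kPostMeasure a L x τ := by
  have hk := measurable_kdens a hLm x τ
  have hnn : ∀ κ ∈ Ioo (0:ℝ) 1, 0 ≤ kdens a L x τ κ := fun κ hκ => (kdens_pos a hL x hτ hκ).le
  have hD : ∫ κ in Ioo (0:ℝ) 1, kdens a L x τ κ =
      (∫⁻ κ in Ioo (0:ℝ) 1, ENNReal.ofReal (kdens a L x τ κ)).toReal :=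
    integral_eq_lintegral_of_nonneg_ae
      ((ae_restrict_iff' measurableSet_Ioo).2 (.of_forall hnn)) hk.aestronglyMeasurable
  rw [kPostMeasure, integral_smul_measure, integral_withDensity_eq_integral_toReal_smul
    (by fun_prop) (.of_forall fun _ => ENNReal.ofReal_lt_top), ENNReal.toReal_inv, ← hD, E1mK,
    kExp, div_eq_inv_mul, smul_eq_mul]
  congr 1
  refine setIntegral_congr_fun measurableSet_Ioo fun κ hκ => ?_
  simp only [smul_eq_mul]
  rw [ENNReal.toReal_ofReal (hnn κ hκ), mul_comm]

/-- Posterior second moment of `θ` around `c`. -/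
def postSq (a : ℝ) (L : ℝ → ℝ) (x τ c : ℝ) : ENNReal :=
  ∫⁻ κ, ENNReal.ofReal ((1 - κ) + ((1 - κ) * x - c)^2) ∂kPostMeasure a L x τ

lemma ofReal_postMean_sub_sq_le (a : ℝ) {L : ℝ → ℝ} (hLm : Measurable L)
    (hL : ∀ t, 0 < t → 0 < L t)
    (hI : IntegrableOn (fun t => t ^ (-a-1) * L t) (Ioi (0:ℝ))) (x : ℝ) {τ : ℝ} (hτ : 0 < τ)
    (c : ℝ) : ENNReal.ofReal ((postMean a L τ x - c)^2) ≤ postSq a L x τ c := by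
  have := isProbabilityMeasure_kPostMeasure a hLm hL hI x hτ
  have hae := ae_kPostMeasure_mem_Ioo a L x τ
  have hb : ∀ κ ∈ Ioo (0:ℝ) 1, |(1 - κ) * x - c| ≤ |x| + |c| := fun κ hκ => by
    refine (abs_sub _ _).trans ?_
    rw [abs_mul, abs_of_pos (by linarith [hκ.2] : 0 < 1 - κ)]
    nlinarith [abs_nonneg x, hκ.1]
  have h1 : Integrable (fun κ : ℝ => (1 - κ) * x - c) (kPostMeasure a L x τ) := by
    refine Integrable.of_bound (by fun_prop) (|x| + |c|) ?_
    filter_upwards [hae] with κ hκ using hb κ hκ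
  have h2 : Integrable (fun κ : ℝ => ((1 - κ) * x - c)^2) (kPostMeasure a L x τ) := by
    refine Integrable.of_bound (by fun_prop) ((|x| + |c|)^2) ?_
    filter_upwards [hae] with κ hκ
    rw [norm_pow]
    exact pow_le_pow_left₀ (norm_nonneg _) (hb κ hκ) 2
  have h0 : Integrable (fun κ : ℝ => 1 - κ) (kPostMeasure a L x τ) := by
    refine Integrable.of_bound (by fun_prop) 1 ?_
    filter_upwards [hae] with κ hκ
    rw [Real.norm_eq_abs, abs_of_pos (by linarith [hκ.2])]
    linarith [hκ.1]
  have e : postMean a L τ x - c = ∫ κ, ((1 - κ) * x - c) ∂kPostMeasure a L x τ := by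
    rw [integral_sub (h0.mul_const x) (integrable_const c), integral_mul_const,
      ← E1mK_eq_integral a hLm hL x hτ, postMean]
    simp [mul_comm]
  have hJ := (even_two.convexOn_pow (𝕜 := ℝ)).map_integral_le (by fun_prop) isClosed_univ
    (.of_forall fun _ => mem_univ _) h1 h2
  rw [e]
  refine (ENNReal.ofReal_le_ofReal hJ).trans ?_
  rw [ofReal_integral_eq_lintegral_ofReal h2 (.of_forall fun _ => sq_nonneg _), postSq]
  refine lintegral_mono_ae ?_
  filter_upwards [hae] with κ hκ
  refine ENNReal.ofReal_le_ofReal ?_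
  linarith [hκ.2]

lemma measurable_gaussian_kernel (x : ℝ) :
    Measurable fun κ : ℝ => gaussianReal ((1-κ)*x) (Real.toNNReal (1-κ)) :=
  measurable_gaussianReal.comp (f := fun κ : ℝ => ((1-κ)*x, Real.toNNReal (1-κ))) (by fun_prop)

lemma isProbabilityMeasure_thetaPost (a : ℝ) {L : ℝ → ℝ} (hLm : Measurable L)
    (hL : ∀ t, 0 < t → 0 < L t)
    (hI : IntegrableOn (fun t => t ^ (-a-1) * L t) (Ioi (0:ℝ))) (x : ℝ) {τ : ℝ} (hτ : 0 < τ) :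
    IsProbabilityMeasure (thetaPost a L x τ) := by
  have := isProbabilityMeasure_kPostMeasure a hLm hL hI x hτ
  constructor
  rw [thetaPost, Measure.bind_apply .univ (measurable_gaussian_kernel x).aemeasurable]
  simp

lemma lintegral_sub_sq_gaussianReal (m c : ℝ) (v : NNReal) :
    ∫⁻ θ, ENNReal.ofReal ((θ - c)^2) ∂gaussianReal m v =
      ENNReal.ofReal (v + (m - c)^2) := by
  have hid : MemLp id 2 (gaussianReal m v) := memLp_id_gaussianReal 2
  have h1 : Integrable (fun θ : ℝ => θ) (gaussianReal m v) := hid.integrable (by norm_num)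
  have h2 : Integrable (fun θ : ℝ => θ^2) (gaussianReal m v) := hid.integrable_sq
  have hvar : ∫ θ, θ^2 ∂gaussianReal m v = v + m^2 := by
    have h := variance_eq_sub hid
    rw [variance_id_gaussianReal] at h
    simp only [Pi.pow_apply, id] at h
    rw [integral_id_gaussianReal] at h
    linarith
  have e : (fun θ : ℝ => (θ - c)^2) = fun θ => θ^2 - 2 * c * θ + c^2 := by
    ext θ; ring
  have h3 : Integrable (fun θ : ℝ => θ^2 - 2 * c * θ) (gaussianReal m v) :=
    h2.sub (h1.const_mul (2 * c))
  have hi : Integrable (fun θ : ℝ => (θ - c)^2) (gaussianReal m v) := by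
    rw [e]
    exact h3.add (integrable_const _)
  rw [← ofReal_integral_eq_lintegral_ofReal hi (.of_forall fun _ => sq_nonneg _), e,
    integral_add h3 (integrable_const _),
    integral_sub h2 (h1.const_mul (2 * c)), integral_const_mul, integral_id_gaussianReal, hvar]
  congr 1
  simp
  ring

lemma lintegral_sub_sq_thetaPost (a : ℝ) (L : ℝ → ℝ) (x τ c : ℝ) :
    ∫⁻ θ, ENNReal.ofReal ((θ - c)^2) ∂thetaPost a L x τ = postSq a L x τ c := by
  rw [thetaPost, Measure.lintegral_bind (measurable_gaussian_kernel x).aemeasurable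
    (by fun_prop), postSq]
  refine lintegral_congr_ae ?_
  filter_upwards [ae_kPostMeasure_mem_Ioo a L x τ] with κ hκ
  rw [lintegral_sub_sq_gaussianReal, Real.coe_toNNReal _ (by linarith [hκ.2])]

lemma lintegral_sub_sq_thetaPost_le (a : ℝ) {L : ℝ → ℝ} (hLm : Measurable L)
    (hL : ∀ t, 0 < t → 0 < L t)
    (hI : IntegrableOn (fun t => t ^ (-a-1) * L t) (Ioi (0:ℝ))) (x : ℝ) {τ : ℝ} (hτ : 0 < τ)
    (b c : ℝ) :
    ∫⁻ θ, ENNReal.ofReal ((θ - b)^2) ∂thetaPost a L x τ ≤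
      2 * postSq a L x τ c + 2 * ENNReal.ofReal ((b - c)^2) := by
  have := isProbabilityMeasure_thetaPost a hLm hL hI x hτ
  calc _ ≤ ∫⁻ θ, (2 * ENNReal.ofReal ((θ - c)^2) + 2 * ENNReal.ofReal ((b - c)^2))
        ∂thetaPost a L x τ := by
        refine lintegral_mono fun θ => ?_
        rw [show (2 : ENNReal) = ENNReal.ofReal 2 by simp, ← ENNReal.ofReal_mul (by norm_num),
          ← ENNReal.ofReal_mul (by norm_num), ← ENNReal.ofReal_add (by positivity) (by positivity)]
        refine ENNReal.ofReal_le_ofReal ?_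
        nlinarith [sq_nonneg (θ - c + (b - c))]
    _ = _ := by
        rw [lintegral_add_right _ measurable_const, lintegral_const_mul _ (by fun_prop),
          lintegral_sub_sq_thetaPost]
        simp

/-- Markov's inequality for the squared error under the product posterior. -/
lemma PiTau_lt_sum_sq_le (a : ℝ) {L : ℝ → ℝ} (hLm : Measurable L)
    (hL : ∀ t, 0 < t → 0 < L t)
    (hI : IntegrableOn (fun t => t ^ (-a-1) * L t) (Ioi (0:ℝ))) {n : ℕ} (X : Fin n → ℝ)
    {τ : ℝ} (hτ : 0 < τ) (b : Fin n → ℝ) {R : ℝ} (hR : 0 < R) :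
    PiTau a L n X τ {θ | R < ∑ i, (θ i - b i)^2} ≤
      (∑ i, ∫⁻ θ, ENNReal.ofReal ((θ - b i)^2) ∂thetaPost a L (X i) τ) / ENNReal.ofReal R := by
  have hp : ∀ i, IsProbabilityMeasure (thetaPost a L (X i) τ) := fun i =>
    isProbabilityMeasure_thetaPost a hLm hL hI (X i) hτ
  have hm : Measurable fun θ : Fin n → ℝ => ∑ i, ENNReal.ofReal ((θ i - b i)^2) := by fun_prop
  calc _ ≤ PiTau a L n X τ {θ | ENNReal.ofReal R ≤ ∑ i, ENNReal.ofReal ((θ i - b i)^2)} := by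
        refine measure_mono fun θ hθ => ?_
        simp only [Set.mem_ofPred_eq] at hθ ⊢
        rw [← ENNReal.ofReal_sum_of_nonneg fun i _ => sq_nonneg _]
        exact ENNReal.ofReal_le_ofReal hθ.le
    _ ≤ _ := meas_ge_le_lintegral_div hm.aemeasurable (by simpa using hR) ENNReal.ofReal_ne_top
    _ = _ := by
        rw [lintegral_finsetSum _ (by fun_prop)]
        congr 1
        refine Finset.sum_congr rfl fun i _ => ?_
        exact (measurePreserving_eval (fun i => thetaPost a L (X i) τ) i).lintegral_comp
          (f := fun θ => ENNReal.ofReal ((θ - b i)^2)) (by fun_prop)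

lemma postSq_le_of_lintegral_le (a : ℝ) {L : ℝ → ℝ} (hLm : Measurable L)
    (hL : ∀ t, 0 < t → 0 < L t) (x : ℝ) {τ : ℝ} (hτ : 0 < τ)
    (c : ℝ) {B : ENNReal}
    (h : ∫⁻ κ in Ioo (0:ℝ) 1, ENNReal.ofReal (((1 - κ) + ((1 - κ) * x - c)^2) * kdens a L x τ κ) ≤
      B * ∫⁻ κ in Ioo (0:ℝ) 1, ENNReal.ofReal (kdens a L x τ κ)) :
    postSq a L x τ c ≤ B := by
  rw [postSq, lintegral_kPostMeasure a hLm x τ (by fun_prop), mul_comm, ← div_eq_mul_inv]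
  refine ENNReal.div_le_of_le_mul (le_trans (le_of_eq ?_) h)
  refine setLIntegral_congr_fun measurableSet_Ioo fun κ hκ => ?_
  rw [← ENNReal.ofReal_mul (kdens_pos a hL x hτ hκ).le, mul_comm]

lemma postSq_zero_le (a : ℝ) {L : ℝ → ℝ} (hLm : Measurable L)
    (hL : ∀ t, 0 < t → 0 < L t)
    (hI : IntegrableOn (fun t => t ^ (-a-1) * L t) (Ioi (0:ℝ))) (x : ℝ) {τ : ℝ} (hτ : 0 < τ) :
    postSq a L x τ 0 ≤ ENNReal.ofReal (1 + x^2) := by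
  have := isProbabilityMeasure_kPostMeasure a hLm hL hI x hτ
  calc postSq a L x τ 0 ≤ ∫⁻ _, ENNReal.ofReal (1 + x^2) ∂kPostMeasure a L x τ := by
        refine lintegral_mono_ae ?_
        filter_upwards [ae_kPostMeasure_mem_Ioo a L x τ] with κ hκ
        refine ENNReal.ofReal_le_ofReal ?_
        have h1 : (1 - κ)^2 ≤ 1 := by nlinarith [hκ.1, hκ.2]
        nlinarith [hκ.1, sq_nonneg x]
    _ = _ := by simp

lemma exists_postSq_zero_le {a : ℝ} (ha : 1/2 ≤ a) {L : ℝ → ℝ} {Mb : ℝ}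
    (hLm : Measurable L) (hL : ∀ t, 0 < t → 0 < L t) (hM : ∀ t, 0 < t → L t ≤ Mb)
    (hI : IntegrableOn (fun t => t ^ (-a-1) * L t) (Ioi (0:ℝ))) :
    ∃ C : ℝ, 0 < C ∧ ∀ τ : ℝ, 0 < τ → τ ≤ 1 → ∀ x : ℝ,
      postSq a L x τ 0 ≤ ENNReal.ofReal (C * (τ * Real.exp (x^2/2))) := by
  obtain ⟨C, hC, h⟩ := exists_lintegral_sq_mul_kdens_le ha hLm hL hM hI
  obtain ⟨c, hc, hD⟩ := exists_le_lintegral_kdens a hLm hL hI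
  refine ⟨C / c, by positivity, fun τ hτ hτ1 x => ?_⟩
  refine postSq_le_of_lintegral_le a hLm hL x hτ 0 ?_
  simp only [sub_zero]
  refine (h τ hτ hτ1 x).trans (le_trans (le_of_eq ?_) (mul_le_mul_right (hD τ hτ hτ1 x) _))
  rw [← ENNReal.ofReal_mul (by positivity)]
  congr 1
  field_simp

lemma exists_postSq_self_le {a : ℝ} (ha : 1/2 ≤ a) {L : ℝ → ℝ} {Mb c0 t0 : ℝ}
    (hLm : Measurable L) (hL : ∀ t, 0 < t → 0 < L t) (hM : ∀ t, 0 < t → L t ≤ Mb)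
    (hc0 : 0 < c0) (ht0 : 0 < t0) (hA : ∀ t, t0 ≤ t → c0 ≤ L t)
    (hI : IntegrableOn (fun t => t ^ (-a-1) * L t) (Ioi (0:ℝ))) :
    ∃ C : ℝ, 0 < C ∧ ∀ τ : ℝ, 0 < τ → τ ≤ 1 → ∀ x : ℝ,
      postSq a L x τ x ≤ ENNReal.ofReal (C * (1 - Real.log τ)) := by
  obtain ⟨C, hC, h⟩ := exists_lintegral_mul_kappa_sq_mul_kdens_le ha hLm hL hM hc0 ht0 hA hI
  refine ⟨C + 1, by positivity, fun τ hτ hτ1 x => ?_⟩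
  have hlog : Real.log τ ≤ 0 := Real.log_nonpos hτ.le hτ1
  have hl0 : 0 ≤ 1 - Real.log τ := by linarith
  have hk := measurable_kdens a hLm x τ
  refine postSq_le_of_lintegral_le a hLm hL x hτ x ?_
  calc _ ≤ ∫⁻ κ in Ioo (0:ℝ) 1, (ENNReal.ofReal (kdens a L x τ κ) +
        ENNReal.ofReal ((κ * x)^2 * kdens a L x τ κ)) := by
        refine setLIntegral_mono' measurableSet_Ioo fun κ hκ => ?_
        have hp := kdens_pos a hL x hτ hκ
        rw [← ENNReal.ofReal_add (by positivity) (by positivity)]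
        refine ENNReal.ofReal_le_ofReal ?_
        nlinarith [mul_pos hκ.1 hp]
    _ = _ := lintegral_add_left (by fun_prop) _
    _ ≤ ENNReal.ofReal 1 * (∫⁻ κ in Ioo (0:ℝ) 1, ENNReal.ofReal (kdens a L x τ κ)) +
        ENNReal.ofReal (C * (1 - Real.log τ)) *
          ∫⁻ κ in Ioo (0:ℝ) 1, ENNReal.ofReal (kdens a L x τ κ) :=
        add_le_add (by simp) (h τ hτ hτ1 x)
    _ ≤ _ := by
        rw [← add_mul, ← ENNReal.ofReal_add (by norm_num) (by positivity)]
        refine mul_le_mul_left (ENNReal.ofReal_le_ofReal ?_) _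
        nlinarith

lemma one_div_le_tauHat (c1 c2 : ℝ) (n : ℕ) (x : Fin n → ℝ) : 1 / (n:ℝ) ≤ tauHat c1 c2 n x :=
  le_max_left _ _

lemma tauHat_le_max {c1 c2 : ℝ} (hc2 : 1 ≤ c2) (n : ℕ) (x : Fin n → ℝ) :
    tauHat c1 c2 n x ≤ max (1/(n:ℝ))
      ((∑ i, if Real.sqrt (c1 * Real.log n) < |x i| then (1:ℝ) else 0) / n) := by
  refine max_le_max le_rfl ?_
  have h : (0:ℝ) ≤ ∑ i, if Real.sqrt (c1 * Real.log n) < |x i| then (1:ℝ) else 0 :=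
    Finset.sum_nonneg fun i _ => by split_ifs <;> norm_num
  rw [one_div, mul_inv, mul_assoc, div_eq_inv_mul]
  exact mul_le_of_le_one_left (by positivity) (inv_le_one_of_one_le₀ hc2)

lemma tauHat_le_one {c1 c2 : ℝ} (hc2 : 1 ≤ c2) {n : ℕ} (hn : 1 ≤ n) (x : Fin n → ℝ) :
    tauHat c1 c2 n x ≤ 1 := by
  have hn' : (1:ℝ) ≤ n := by exact_mod_cast hn
  refine (tauHat_le_max hc2 n x).trans (max_le ?_ ?_)
  · rw [div_le_one (by positivity)]; exact hn'
  · rw [div_le_one (by positivity)]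
    calc _ ≤ ∑ i : Fin n, (1:ℝ) := Finset.sum_le_sum fun i _ => by split_ifs <;> norm_num
      _ = n := by simp

/-- Exponential upper bound for the indicator of `|x| > √(c₁ log n)`. -/
def tailBd (n : ℕ) (x : ℝ) : ℝ :=
  ((n:ℝ)^2)⁻¹ * (Real.exp (Real.sqrt (2 * Real.log n) * x) +
    Real.exp (-Real.sqrt (2 * Real.log n) * x))

lemma tailBd_nonneg (n : ℕ) (x : ℝ) : 0 ≤ tailBd n x := by unfold tailBd; positivity

lemma one_le_tailBd {c1 : ℝ} (hc1 : 2 ≤ c1) {n : ℕ} (hn : 1 ≤ n) {x : ℝ}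
    (hx : Real.sqrt (c1 * Real.log n) < |x|) : 1 ≤ tailBd n x := by
  have hn' : (1:ℝ) ≤ n := by exact_mod_cast hn
  have hl : 0 ≤ Real.log n := Real.log_nonneg hn'
  set t := Real.sqrt (2 * Real.log n) with ht
  have ht2 : t * t = 2 * Real.log n := Real.mul_self_sqrt (by positivity)
  have htx : t ≤ |x| :=
    (Real.sqrt_le_sqrt (mul_le_mul_of_nonneg_right hc1 hl)).trans hx.le
  have ht0 : 0 ≤ t := Real.sqrt_nonneg _
  have h1 : Real.exp (t * |x|) ≤ Real.exp (t * x) + Real.exp (-t * x) := by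
    rcases abs_cases x with ⟨h, _⟩ | ⟨h, _⟩ <;> rw [h]
    · linarith [Real.exp_pos (-t * x)]
    · rw [mul_neg, ← neg_mul]; linarith [Real.exp_pos (t * x)]
  have h2 : (n:ℝ)^2 ≤ Real.exp (t * |x|) := by
    have : Real.exp (2 * Real.log n) = (n:ℝ)^2 := by
      rw [two_mul, Real.exp_add, Real.exp_log (by positivity), sq]
    rw [← this]
    exact Real.exp_le_exp.2 (by nlinarith)
  rw [tailBd, ← ht, ← div_eq_inv_mul, one_le_div (by positivity)]
  exact h2.trans h1

lemma integrable_tailBd (n : ℕ) : Integrable (tailBd n) (gaussianReal 0 1) :=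
  ((integrable_exp_mul_gaussianReal _).add (integrable_exp_mul_gaussianReal _)).const_mul _

lemma integral_tailBd {n : ℕ} (hn : 1 ≤ n) : ∫ x, tailBd n x ∂gaussianReal 0 1 = 2 / n := by
  have hn' : (1:ℝ) ≤ n := by exact_mod_cast hn
  have hl : 0 ≤ Real.log n := Real.log_nonneg hn'
  have key : ∀ t : ℝ, ∫ x, Real.exp (t * x) ∂gaussianReal 0 1 = Real.exp (t^2/2) := fun t => by
    have := congrFun (mgf_id_gaussianReal (μ := 0) (v := 1)) t
    simpa [mgf] using this
  unfold tailBd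
  rw [integral_const_mul, integral_add (integrable_exp_mul_gaussianReal _)
    (integrable_exp_mul_gaussianReal _), key, key, neg_sq, Real.sq_sqrt (by positivity),
    mul_div_cancel_left₀ _ (two_ne_zero), Real.exp_log (by positivity)]
  field_simp
  norm_num

lemma integrable_exp_mul_sq_gaussianReal {b : ℝ} (hb : b < 1/2) :
    Integrable (fun x : ℝ => Real.exp (b * x^2)) (gaussianReal 0 1) := by
  rw [gaussianReal_of_var_ne_zero _ one_ne_zero,
    integrable_withDensity_iff_integrable_smul' (measurable_gaussianPDF 0 1)
    (.of_forall fun _ => gaussianPDF_lt_top)]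
  have h := (integrable_exp_neg_mul_sq (b := 1/2 - b) (by linarith)).const_mul
    (Real.sqrt (2 * Real.pi))⁻¹
  refine h.congr (.of_forall fun x => ?_)
  simp only [gaussianPDF, smul_eq_mul]
  rw [ENNReal.toReal_ofReal (gaussianPDFReal_nonneg _ _ _), gaussianPDFReal]
  simp only [NNReal.coe_one, mul_one, sub_zero]
  rw [mul_assoc, ← Real.exp_add]
  congr 2
  ring

lemma integral_indicator_exp_sq_le {z : ℝ} (hz : 0 ≤ z) :
    Integrable ((Icc (-z) z).indicator fun x : ℝ => Real.exp (x^2/2)) (gaussianReal 0 1) ∧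
    ∫ x, (Icc (-z) z).indicator (fun x : ℝ => Real.exp (x^2/2)) x ∂gaussianReal 0 1 ≤ z := by
  constructor
  · refine Integrable.of_bound (C := Real.exp (z^2/2)) ?_ (.of_forall fun x => ?_)
    · exact (Measurable.indicator (by fun_prop) measurableSet_Icc).aestronglyMeasurable
    · by_cases hx : x ∈ Icc (-z) z
      · rw [indicator_of_mem hx, Real.norm_eq_abs, Real.abs_exp]
        refine Real.exp_le_exp.2 ?_
        have := sq_le_sq' hx.1 hx.2
        linarith
      · rw [indicator_of_notMem hx]; simp [Real.exp_nonneg]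
  · rw [integral_gaussianReal_eq_integral_smul one_ne_zero]
    have e : ∀ x : ℝ, gaussianPDFReal 0 1 x •
        (Icc (-z) z).indicator (fun x : ℝ => Real.exp (x^2/2)) x =
        (Icc (-z) z).indicator (fun _ => (Real.sqrt (2 * Real.pi))⁻¹) x := fun x => by
      by_cases hx : x ∈ Icc (-z) z
      · simp only [indicator_of_mem hx, gaussianPDFReal, smul_eq_mul]
        simp only [NNReal.coe_one, mul_one, sub_zero]
        rw [mul_assoc, ← Real.exp_add]
        have : -x^2/2 + x^2/2 = 0 := by ring
        rw [this, Real.exp_zero, mul_one]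
      · simp [indicator_of_notMem hx]
    simp_rw [e]
    rw [integral_indicator measurableSet_Icc, setIntegral_const, Real.volume_real_Icc_of_le
      (by linarith), smul_eq_mul]
    have h2 : 2 ≤ Real.sqrt (2 * Real.pi) :=
      Real.le_sqrt_of_sq_le (by nlinarith [Real.pi_gt_three])
    have h3 : (Real.sqrt (2 * Real.pi))⁻¹ ≤ 2⁻¹ := inv_anti₀ (by norm_num) h2
    nlinarith

/-- Upper bound for the posterior second moment of a null coordinate. -/
def nullBd (C r : ℝ) (n : ℕ) (x : ℝ) : ℝ :=
  C * r * (Icc (-(2 * Real.sqrt (Real.log n))) (2 * Real.sqrt (Real.log n))).indicator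
      (fun x : ℝ => Real.exp (x^2/2)) x +
    8 / n * Real.exp (3/8 * x^2)

lemma nullBd_nonneg {C r : ℝ} (hC : 0 ≤ C) (hr : 0 ≤ r) (n : ℕ) (x : ℝ) :
    0 ≤ nullBd C r n x := by
  have : 0 ≤ (Icc (-(2 * Real.sqrt (Real.log n))) (2 * Real.sqrt (Real.log n))).indicator
      (fun x : ℝ => Real.exp (x^2/2)) x := indicator_nonneg (fun _ _ => Real.exp_nonneg _) _
  unfold nullBd
  positivity

lemma le_nullBd {C r τ : ℝ} (hC : 0 ≤ C) (hτr : τ ≤ r) {n : ℕ} (hn : 1 ≤ n)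
    (x : ℝ) {p : ENNReal} (h1 : p ≤ ENNReal.ofReal (C * (τ * Real.exp (x^2/2))))
    (h2 : p ≤ ENNReal.ofReal (1 + x^2)) : p ≤ ENNReal.ofReal (nullBd C r n x) := by
  have hn' : (1:ℝ) ≤ n := by exact_mod_cast hn
  have hl : 0 ≤ Real.log n := Real.log_nonneg hn'
  unfold nullBd
  by_cases hx : x ∈ Icc (-(2 * Real.sqrt (Real.log n))) (2 * Real.sqrt (Real.log n))
  · refine h1.trans (ENNReal.ofReal_le_ofReal ?_)
    rw [indicator_of_mem hx]
    have : 0 ≤ 8 / n * Real.exp (3/8 * x^2) := by positivity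
    have h3 : C * (τ * Real.exp (x^2/2)) ≤ C * (r * Real.exp (x^2/2)) := by gcongr
    linarith
  · refine h2.trans (ENNReal.ofReal_le_ofReal ?_)
    rw [indicator_of_notMem hx, mul_zero, zero_add]
    have hz : 4 * Real.log n ≤ x^2 := by
      have h4 : 2 * Real.sqrt (Real.log n) ≤ |x| := by
        by_contra! hlt
        exact hx (abs_le.1 hlt.le)
      have := pow_le_pow_left₀ (by positivity) h4 2
      rw [sq_abs, mul_pow, Real.sq_sqrt hl] at this
      linarith
    have h5 : (n:ℝ) ≤ Real.exp (x^2/4) := by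
      rw [← Real.log_le_iff_le_exp (by positivity)]
      linarith
    have h6 : 1 + x^2 ≤ 8 * Real.exp (x^2/8) := by
      have := Real.add_one_le_exp (x^2/8)
      linarith
    rw [show 3/8 * x^2 = x^2/8 + x^2/4 by ring, Real.exp_add, div_mul_eq_mul_div,
      le_div_iff₀ (by positivity)]
    calc (1 + x^2) * n ≤ (8 * Real.exp (x^2/8)) * Real.exp (x^2/4) := by gcongr
      _ = _ := by ring

lemma integrable_nullBd (C r : ℝ) (n : ℕ) : Integrable (nullBd C r n) (gaussianReal 0 1) :=
  ((integral_indicator_exp_sq_le (by positivity)).1.const_mul _).add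
    ((integrable_exp_mul_sq_gaussianReal (by norm_num)).const_mul _)

lemma integral_nullBd_le {C r : ℝ} (hC : 0 ≤ C) (hr : 0 ≤ r) (n : ℕ) :
    ∫ x, nullBd C r n x ∂gaussianReal 0 1 ≤ C * r * (2 * Real.sqrt (Real.log n)) +
      8 / n * ∫ x, Real.exp (3/8 * x^2) ∂gaussianReal 0 1 := by
  have h := integral_indicator_exp_sq_le (z := 2 * Real.sqrt (Real.log n)) (by positivity)
  unfold nullBd
  rw [integral_add (h.1.const_mul _)
    ((integrable_exp_mul_sq_gaussianReal (by norm_num)).const_mul _), integral_const_mul,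
    integral_const_mul]
  have := mul_le_mul_of_nonneg_left h.2 (mul_nonneg hC hr)
  linarith

lemma integrable_sub_sq_gaussianReal (m : ℝ) :
    Integrable (fun x : ℝ => (x - m)^2) (gaussianReal m 1) :=
  ((memLp_id_gaussianReal 2).sub (memLp_const m)).integrable_sq

lemma integral_sub_sq_gaussianReal (m : ℝ) : ∫ x, (x - m)^2 ∂gaussianReal m 1 = 1 := by
  have h := ofReal_integral_eq_lintegral_ofReal (integrable_sub_sq_gaussianReal m)
    (.of_forall fun _ => sq_nonneg _)
  rw [lintegral_sub_sq_gaussianReal] at h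
  simp only [NNReal.coe_one, sub_self, ne_eq, OfNat.ofNat_ne_zero, not_false_eq_true, zero_pow,
    add_zero] at h
  rwa [ENNReal.ofReal_eq_ofReal_iff (integral_nonneg fun _ => sq_nonneg _) (by norm_num)] at h

lemma integral_sum_eval_Pmeas {n : ℕ} (θ0 : Fin n → ℝ) {f : Fin n → ℝ → ℝ}
    (hf : ∀ i, Integrable (f i) (gaussianReal (θ0 i) 1)) :
    Integrable (fun x => ∑ i, f i (x i)) (Pmeas n θ0) ∧
    ∫ x, ∑ i, f i (x i) ∂Pmeas n θ0 = ∑ i, ∫ y, f i y ∂gaussianReal (θ0 i) 1 := by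
  have hmp : ∀ i, MeasurePreserving (fun x : Fin n → ℝ => x i) (Pmeas n θ0)
      (gaussianReal (θ0 i) 1) := fun i => measurePreserving_eval _ i
  have hi : ∀ i, Integrable (fun x : Fin n → ℝ => f i (x i)) (Pmeas n θ0) := fun i =>
    (hmp i).integrable_comp_of_integrable (hf i)
  refine ⟨integrable_finsetSum _ fun i _ => hi i, ?_⟩
  rw [integral_finsetSum _ fun i _ => hi i]
  refine Finset.sum_congr rfl fun i _ => ?_
  rw [← (hmp i).map_eq, integral_map (hmp i).measurable.aemeasurable]
  rw [(hmp i).map_eq]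
  exact (hf i).aestronglyMeasurable

lemma sparse.sum_ite_le {n q : ℕ} {θ0 : Fin n → ℝ} (h : sparse n q θ0) :
    ∑ i, (if θ0 i ≠ 0 then (1:ℝ) else 0) ≤ q := by
  classical
  rw [sparse, Nat.card_eq_fintype_card, Fintype.card_subtype] at h
  rw [Finset.sum_boole]
  exact_mod_cast h

/-- Integrable upper bound for the contribution of one coordinate with true mean `m`
to the posterior squared error. -/
def coordBd (C1 C r : ℝ) (n : ℕ) (m x : ℝ) : ℝ :=
  if m ≠ 0 then 8 * C1 * Real.log n + 2 * (x - m)^2 else 4 * nullBd C r n x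

lemma coordBd_nonneg {C1 C r : ℝ} (hC1 : 0 ≤ C1) (hC : 0 ≤ C) (hr : 0 ≤ r) {n : ℕ} (hn : 1 ≤ n)
    (m x : ℝ) : 0 ≤ coordBd C1 C r n m x := by
  have hl : 0 ≤ Real.log n := Real.log_nonneg (by exact_mod_cast hn)
  have := nullBd_nonneg hC hr n x
  unfold coordBd
  split_ifs <;> positivity

lemma integrable_coordBd (C1 C r : ℝ) (n : ℕ) (m : ℝ) :
    Integrable (coordBd C1 C r n m) (gaussianReal m 1) := by
  unfold coordBd
  by_cases hm : m = 0
  · subst hm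
    simpa using (integrable_nullBd C r n).const_mul 4
  · simp only [ne_eq, hm, not_false_eq_true, if_true]
    exact (integrable_const _).add ((integrable_sub_sq_gaussianReal m).const_mul 2)

lemma integral_coordBd_le (C1 : ℝ) {C r : ℝ} (hC : 0 ≤ C) (hr : 0 ≤ r) (n : ℕ) (m : ℝ) :
    ∫ x, coordBd C1 C r n m x ∂gaussianReal m 1 ≤
      if m ≠ 0 then 8 * C1 * Real.log n + 2 else
        4 * (C * r * (2 * Real.sqrt (Real.log n)) +
          8 / n * ∫ x, Real.exp (3/8 * x^2) ∂gaussianReal 0 1) := by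
  unfold coordBd
  by_cases hm : m = 0
  · subst hm
    simp only [ne_eq, not_true_eq_false, if_false]
    rw [integral_const_mul]
    exact mul_le_mul_of_nonneg_left (integral_nullBd_le hC hr n) (by norm_num)
  · simp only [ne_eq, hm, not_false_eq_true, if_true]
    rw [integral_add (integrable_const _) ((integrable_sub_sq_gaussianReal m).const_mul 2),
      integral_const_mul 2, integral_sub_sq_gaussianReal]
    simp

/-- A centring vector `b` of the posterior of `θ` given `(X, τ)` such as the posterior mean or the
true mean `θ0`. -/
def IsCenter (a : ℝ) (L : ℝ → ℝ) {n : ℕ} (θ0 X : Fin n → ℝ) (τ : ℝ) (b : Fin n → ℝ) : Prop :=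
  ∀ i c, ENNReal.ofReal ((b i - c)^2) ≤
    postSq a L (X i) τ c + ENNReal.ofReal ((θ0 i - c)^2)

lemma one_le_log_natCast {n : ℕ} (hn : 3 ≤ n) : 1 ≤ Real.log n := by
  have h3 : (3:ℝ) ≤ n := by exact_mod_cast hn
  rw [Real.le_log_iff_exp_le (by positivity)]
  linarith [Real.exp_one_lt_d9]

lemma sum_lintegral_le {a : ℝ} {L : ℝ → ℝ} (hLm : Measurable L)
    (hL : ∀ t, 0 < t → 0 < L t)
    (hI : IntegrableOn (fun t => t ^ (-a-1) * L t) (Ioi (0:ℝ))) {C C1 : ℝ} (hC : 0 < C)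
    (hC1 : 0 < C1)
    (h0 : ∀ τ : ℝ, 0 < τ → τ ≤ 1 → ∀ x : ℝ,
      postSq a L x τ 0 ≤ ENNReal.ofReal (C * (τ * Real.exp (x^2/2))))
    (h1 : ∀ τ : ℝ, 0 < τ → τ ≤ 1 → ∀ x : ℝ,
      postSq a L x τ x ≤ ENNReal.ofReal (C1 * (1 - Real.log τ)))
    {n : ℕ} (hn : 3 ≤ n) {τ r : ℝ} (hτ : 1 / (n:ℝ) ≤ τ) (hτ1 : τ ≤ 1) (hτr : τ ≤ r)
    {θ0 X b : Fin n → ℝ} (hb : IsCenter a L θ0 X τ b) :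
    ∑ i, ∫⁻ θ, ENNReal.ofReal ((θ - b i)^2) ∂thetaPost a L (X i) τ ≤
      ENNReal.ofReal (∑ i, coordBd C1 C r n (θ0 i) (X i)) := by
  have hn1 : 1 ≤ n := by omega
  have hn' : (0:ℝ) < n := by exact_mod_cast hn1
  have hτ0 : 0 < τ := lt_of_lt_of_le (by positivity) hτ
  have hl := one_le_log_natCast hn
  have hlog : 1 - Real.log τ ≤ 2 * Real.log n := by
    have := Real.log_le_log (by positivity) hτ
    rw [one_div, Real.log_inv] at this
    linarith
  have key : ∀ i c, ∫⁻ θ, ENNReal.ofReal ((θ - b i)^2) ∂thetaPost a L (X i) τ ≤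
      4 * postSq a L (X i) τ c + 2 * ENNReal.ofReal ((θ0 i - c)^2) := fun i c => by
    refine (lintegral_sub_sq_thetaPost_le a hLm hL hI (X i) hτ0 (b i) c).trans ?_
    calc _ ≤ 2 * postSq a L (X i) τ c + 2 * (postSq a L (X i) τ c +
          ENNReal.ofReal ((θ0 i - c)^2)) := by gcongr; exact hb i c
      _ = _ := by ring
  rw [ENNReal.ofReal_sum_of_nonneg fun i _ =>
    coordBd_nonneg hC1.le hC.le (hτ0.le.trans hτr) hn1 _ _]
  refine Finset.sum_le_sum fun i _ => ?_
  unfold coordBd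
  split_ifs with hi
  · refine (key i (X i)).trans ?_
    calc _ ≤ 4 * ENNReal.ofReal (C1 * (2 * Real.log n)) +
          2 * ENNReal.ofReal ((θ0 i - X i)^2) := by
          gcongr
          exact (h1 τ hτ0 hτ1 (X i)).trans (ENNReal.ofReal_le_ofReal (by gcongr))
      _ = _ := by
          rw [show (4 : ENNReal) = ENNReal.ofReal 4 by simp,
            show (2 : ENNReal) = ENNReal.ofReal 2 by simp, ← ENNReal.ofReal_mul (by norm_num),
            ← ENNReal.ofReal_mul (by norm_num), ← ENNReal.ofReal_add (by positivity)
            (by positivity)]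
          congr 1
          ring
  · refine (key i 0).trans ?_
    rw [not_not.1 hi, ENNReal.ofReal_mul (by norm_num)]
    simp only [sub_self, ne_eq, OfNat.ofNat_ne_zero, not_false_eq_true, zero_pow,
      ENNReal.ofReal_zero, mul_zero, add_zero, ENNReal.ofReal_ofNat]
    gcongr
    exact le_nullBd hC.le hτr hn1 (X i) (h0 τ hτ0 hτ1 (X i))
      (postSq_zero_le a hLm hL hI (X i) hτ0)

lemma sum_exceed_le {c1 : ℝ} (hc1 : 2 ≤ c1) {n q : ℕ} (hn : 1 ≤ n) {θ0 : Fin n → ℝ}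
    (hθ : sparse n q θ0) (x : Fin n → ℝ) :
    ∑ i, (if Real.sqrt (c1 * Real.log n) < |x i| then (1:ℝ) else 0) ≤
      q + ∑ i, if θ0 i ≠ 0 then 0 else tailBd n (x i) := by
  refine le_trans ?_ (add_le_add_left hθ.sum_ite_le _)
  rw [← Finset.sum_add_distrib]
  refine Finset.sum_le_sum fun i _ => ?_
  have := tailBd_nonneg n (x i)
  by_cases hi : θ0 i = 0 <;> by_cases hx : Real.sqrt (c1 * Real.log n) < |x i| <;>
    simp [hi, hx, this, one_le_tailBd hc1 hn]

/-- Uniform nonasymptotic bound on the posterior mass outside a ball around a centring vector. -/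
lemma exists_integral_PiTau_le {a : ℝ} (ha : 1/2 ≤ a) {L : ℝ → ℝ} {Mb c0 t0 : ℝ}
    (hA : AssumpL L Mb c0 t0)
    (hI : IntegrableOn (fun t => t ^ (-a-1) * L t) (Ioi (0:ℝ)))
    {c1 c2 : ℝ} (hc1 : 2 ≤ c1) (hc2 : 1 ≤ c2) :
    ∃ C' : ℝ, ∀ n : ℕ, 3 ≤ n → ∀ q : ℕ, 1 ≤ q → ∀ M : ℝ, 0 < M →
      ∀ θ0 : Fin n → ℝ, sparse n q θ0 → ∀ b : (Fin n → ℝ) → Fin n → ℝ,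
      (∀ x, IsCenter a L θ0 x (tauHat c1 c2 n x) (b x)) →
      ∫ x, ((PiTau a L n x (tauHat c1 c2 n x))
        {θ : Fin n → ℝ | M * (q : ℝ) * Real.log n < ∑ i, (θ i - b x i)^2}).toReal
        ∂(Pmeas n θ0) ≤ 2 / q + C' / M := by
  obtain ⟨hLm, hL, hMb, hc0, ht0, hLt⟩ := hA
  obtain ⟨C, hC, h0⟩ := exists_postSq_zero_le ha hLm hL hMb hI
  obtain ⟨C1, hC1, h1⟩ := exists_postSq_self_le ha hLm hL hMb hc0 ht0 hLt hI
  set C2 := ∫ x, Real.exp (3/8 * x^2) ∂gaussianReal 0 1 with hC2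
  have hC2p : 0 ≤ C2 := integral_nonneg fun _ => (Real.exp_pos _).le
  refine ⟨8 * C1 + 2 + 16 * C + 32 * C2, fun n hn q hq M hM θ0 hθ b hb => ?_⟩
  have hn1 : 1 ≤ n := by omega
  have hn' : (0:ℝ) < n := by exact_mod_cast hn1
  have hq1 : (1:ℝ) ≤ q := by exact_mod_cast hq
  have hq' : (0:ℝ) < q := by linarith
  have hl := one_le_log_natCast hn
  set r : ℝ := 2 * q / n with hr
  have hr0 : 0 ≤ r := by positivity
  have hR : 0 < M * q * Real.log n := by positivity
  set R := M * q * Real.log n with hRdef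
  have hN := integral_sum_eval_Pmeas θ0 (f := fun i y => if θ0 i ≠ 0 then 0 else tailBd n y)
    fun i => by
      by_cases hi : θ0 i = 0
      · simpa [hi] using integrable_tailBd n
      · simp [hi]
  have hG := integral_sum_eval_Pmeas θ0 (f := fun i y => coordBd C1 C r n (θ0 i) y)
    fun i => integrable_coordBd C1 C r n (θ0 i)
  have hNn : ∀ x : Fin n → ℝ, 0 ≤ ∑ i, if θ0 i ≠ 0 then 0 else tailBd n (x i) := fun x =>
    Finset.sum_nonneg fun i _ => by
      split_ifs
      · exact le_rfl
      · exact tailBd_nonneg _ _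
  have hGn : ∀ x : Fin n → ℝ, 0 ≤ ∑ i, coordBd C1 C r n (θ0 i) (x i) := fun x =>
    Finset.sum_nonneg fun i _ => coordBd_nonneg hC1.le hC.le hr0 hn1 _ _
  have hpt : ∀ x : Fin n → ℝ, ((PiTau a L n x (tauHat c1 c2 n x))
      {θ : Fin n → ℝ | R < ∑ i, (θ i - b x i)^2}).toReal ≤
      (∑ i, if θ0 i ≠ 0 then 0 else tailBd n (x i)) / q +
        (∑ i, coordBd C1 C r n (θ0 i) (x i)) / R := fun x => by
    have hτn := one_div_le_tauHat c1 c2 n x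
    have hτ1 := tauHat_le_one (c1 := c1) hc2 hn1 x
    have hτ0 : 0 < tauHat c1 c2 n x := lt_of_lt_of_le (by positivity) hτn
    by_cases hx : ∑ i, (if θ0 i ≠ 0 then 0 else tailBd n (x i)) ≤ q
    · have hτr : tauHat c1 c2 n x ≤ r := by
        refine (tauHat_le_max hc2 n x).trans (max_le ?_ ?_)
        · rw [hr]; gcongr; linarith
        · rw [hr]; gcongr
          linarith [sum_exceed_le hc1 hn1 hθ x]
      refine le_add_of_nonneg_of_le (div_nonneg (hNn x) hq'.le) ?_
      refine ENNReal.toReal_le_of_le_ofReal (div_nonneg (hGn x) hR.le) ?_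
      rw [ENNReal.ofReal_div_of_pos hR]
      refine (PiTau_lt_sum_sq_le a hLm hL hI x hτ0 (b x) hR).trans ?_
      gcongr
      exact sum_lintegral_le hLm hL hI hC hC1 h0 h1 hn hτn hτ1 hτr (hb x)
    · have hp : ∀ i, IsProbabilityMeasure (thetaPost a L (x i) (tauHat c1 c2 n x)) := fun i =>
        isProbabilityMeasure_thetaPost a hLm hL hI (x i) hτ0
      have hP : IsProbabilityMeasure (PiTau a L n x (tauHat c1 c2 n x)) := by
        unfold PiTau; infer_instance
      refine measureReal_le_one.trans (le_add_of_le_of_nonneg ?_ (div_nonneg (hGn x) hR.le))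
      rw [one_le_div hq']
      exact (not_le.1 hx).le
  have hNint : ∫ x, ∑ i, (if θ0 i ≠ 0 then 0 else tailBd n (x i)) ∂Pmeas n θ0 ≤ 2 := by
    rw [hN.2]
    calc _ ≤ ∑ i : Fin n, (2 / n : ℝ) := Finset.sum_le_sum fun i _ => by
          by_cases hi : θ0 i = 0
          · simp [hi, integral_tailBd hn1]
          · simp only [ne_eq, hi, not_false_eq_true, if_true, integral_zero]
            positivity
      _ = 2 := by
          rw [Finset.sum_const, Finset.card_univ, Fintype.card_fin, nsmul_eq_mul]
          field_simp
  have hGint : ∫ x, ∑ i, coordBd C1 C r n (θ0 i) (x i) ∂Pmeas n θ0 ≤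
      (8 * C1 + 2 + 16 * C + 32 * C2) * (q * Real.log n) := by
    rw [hG.2]
    have hs : Real.sqrt (Real.log n) ≤ Real.log n :=
      Real.sqrt_le_iff.2 ⟨by linarith, by nlinarith⟩
    set D := 4 * (C * r * (2 * Real.sqrt (Real.log n)) + 8 / n * C2) with hD
    have hD0 : 0 ≤ D := by positivity
    calc _ ≤ ∑ i, ((8 * C1 * Real.log n + 2) * (if θ0 i ≠ 0 then 1 else 0) + D) :=
          Finset.sum_le_sum fun i _ => by
            refine (integral_coordBd_le C1 hC.le hr0 n (θ0 i)).trans ?_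
            rw [← hC2, ← hD]
            split_ifs <;> linarith
      _ = (8 * C1 * Real.log n + 2) * ∑ i, (if θ0 i ≠ 0 then (1:ℝ) else 0) + n * D := by
          rw [Finset.sum_add_distrib, ← Finset.mul_sum]
          simp
      _ ≤ (8 * C1 * Real.log n + 2) * q + n * D := by
          gcongr
          exact hθ.sum_ite_le
      _ = (8 * C1 * Real.log n + 2) * q + (16 * C * q * Real.sqrt (Real.log n) + 32 * C2) := by
          rw [hD, hr]; field_simp; ring
      _ ≤ (8 * C1 * Real.log n + 2 * Real.log n) * q +
          (16 * C * q * Real.log n + 32 * C2 * (q * Real.log n)) := by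
          have := le_mul_of_one_le_right (show 0 ≤ 32 * C2 by positivity)
            (one_le_mul_of_one_le_of_one_le hq1 hl)
          refine add_le_add ?_ (add_le_add ?_ this) <;> gcongr
          linarith
      _ = _ := by ring
  calc _ ≤ ∫ x, ((∑ i, if θ0 i ≠ 0 then 0 else tailBd n (x i)) / q +
        (∑ i, coordBd C1 C r n (θ0 i) (x i)) / R) ∂Pmeas n θ0 :=
        integral_mono_of_nonneg (.of_forall fun _ => ENNReal.toReal_nonneg)
          ((hN.1.div_const _).add (hG.1.div_const _)) (.of_forall hpt)
    _ = (∫ x, ∑ i, (if θ0 i ≠ 0 then 0 else tailBd n (x i)) ∂Pmeas n θ0) / q +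
        (∫ x, ∑ i, coordBd C1 C r n (θ0 i) (x i) ∂Pmeas n θ0) / R := by
        rw [integral_add (hN.1.div_const _) (hG.1.div_const _), integral_div, integral_div]
    _ ≤ 2 / q + (8 * C1 + 2 + 16 * C + 32 * C2) * (q * Real.log n) / R := by gcongr
    _ = _ := by
        rw [hRdef]; field_simp

/-- A centring vector yields uniform contraction over sparse means. -/
lemma tendsto_iSup_integral_PiTau {a : ℝ} (ha : 1/2 ≤ a) {L : ℝ → ℝ} {Mb c0 t0 : ℝ}
    (hA : AssumpL L Mb c0 t0)
    (hI : IntegrableOn (fun t => t ^ (-a-1) * L t) (Ioi (0:ℝ)))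
    {β : ℝ} (hβ : 0 < β) {q : ℕ → ℕ} (hq : propTo q β)
    {c1 c2 : ℝ} (hc1 : 2 ≤ c1) (hc2 : 1 ≤ c2) {M : ℕ → ℝ} (hM : Tendsto M atTop atTop)
    (b : ∀ n : ℕ, (Fin n → ℝ) → (Fin n → ℝ) → Fin n → ℝ)
    (hb : ∀ n, 1 ≤ n → ∀ θ0 x, IsCenter a L θ0 x (tauHat c1 c2 n x) (b n θ0 x)) :
    Tendsto (fun n : ℕ => ⨆ θ0 : {v : Fin n → ℝ // sparse n (q n) v},
        ∫ x, ((PiTau a L n x (tauHat c1 c2 n x))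
            {θ : Fin n → ℝ | M n * (q n : ℝ) * Real.log n < ∑ i, (θ i - b n θ0.1 x i)^2}).toReal
          ∂(Pmeas n θ0.1))
      atTop (nhds 0) := by
  obtain ⟨C', hC'⟩ := exists_integral_PiTau_le ha hA hI hc1 hc2
  have hqt : Tendsto (fun n => (q n : ℝ)) atTop atTop := by
    obtain ⟨k1, k2, hk1, -, h⟩ := hq
    exact tendsto_atTop_mono' _ (h.mono fun n hn => hn.1)
      (((tendsto_rpow_atTop hβ).comp tendsto_natCast_atTop_atTop).const_mul_atTop hk1)
  have hlim : Tendsto (fun n => 2 / (q n : ℝ) + C' / M n) atTop (nhds 0) := by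
    simpa using (hqt.const_div_atTop 2).add (hM.const_div_atTop C')
  refine tendsto_of_tendsto_of_tendsto_of_le_of_le' tendsto_const_nhds hlim
    (.of_forall fun n => Real.iSup_nonneg fun θ0 => integral_nonneg fun _ =>
      ENNReal.toReal_nonneg) ?_
  filter_upwards [eventually_ge_atTop 3, hqt.eventually_ge_atTop 1, hM.eventually_gt_atTop 0]
    with n hn hqn hMn
  have : Nonempty {v : Fin n → ℝ // sparse n (q n) v} := ⟨⟨0, by simp [sparse]⟩⟩
  exact ciSup_le fun θ0 => hC' n hn (q n) (by exact_mod_cast hqn) (M n) hMn θ0.1 θ0.2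
    (b n θ0.1) (hb n (by omega) θ0.1)

end PaperGL

open PaperGL MeasureTheory ProbabilityTheory Real Filter Set in
/-- Theorem 2: near-minimax contraction of the empirical Bayes posterior
around the truth and around the empirical Bayes posterior mean. -/
theorem stmt6 (a : ℝ) (ha : 1/2 ≤ a) (L : ℝ → ℝ) (Mb c0 t0 K : ℝ)
    (hL : AssumpL L Mb c0 t0) (hK : Kcond a L K)
    (β : ℝ) (hβ : 0 < β ∧ β < 1) (q : ℕ → ℕ) (hq : propTo q β)
    (c1 c2 : ℝ) (hc1 : 2 ≤ c1) (hc2 : 1 ≤ c2)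
    (M : ℕ → ℝ) (hM : Tendsto M atTop atTop) :
    Tendsto (fun n : ℕ => ⨆ θ0 : {v : Fin n → ℝ // sparse n (q n) v},
        ∫ x, ((PiTau a L n x (tauHat c1 c2 n x))
            {θ : Fin n → ℝ | M n * (q n : ℝ) * Real.log n < ∑ i, (θ i - θ0.1 i)^2}).toReal
          ∂(Pmeas n θ0.1))
      atTop (nhds 0) ∧
    Tendsto (fun n : ℕ => ⨆ θ0 : {v : Fin n → ℝ // sparse n (q n) v},
        ∫ x, ((PiTau a L n x (tauHat c1 c2 n x))
            {θ : Fin n → ℝ | M n * (q n : ℝ) * Real.log n <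
              ∑ i, (θ i - postMean a L (tauHat c1 c2 n x) (x i))^2}).toReal
          ∂(Pmeas n θ0.1))
      atTop (nhds 0) := by
  refine ⟨tendsto_iSup_integral_PiTau ha hL hK.1 hβ.1 hq hc1 hc2 hM (fun _ θ0 _ => θ0) ?_,
    tendsto_iSup_integral_PiTau ha hL hK.1 hβ.1 hq hc1 hc2 hM
      (fun n _ x i => postMean a L (tauHat c1 c2 n x) (x i)) ?_⟩
  · exact fun n _ θ0 x i c => le_add_self
  · intro n hn θ0 x i c
    have hn' : (0:ℝ) < n := by exact_mod_cast hn
    exact (ofReal_postMean_sub_sq_le a hL.1 hL.2.1 hK.1 (x i)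
      (lt_of_lt_of_le (by positivity) (one_div_le_tauHat c1 c2 n x)) c).trans le_self_add
end
end

section
/- Suppose a ∈ (0,1), L satisfies Assumptions A1 and A2, and π_{2n} satisfies (C3). Then there exist a constant C > 0 and a sequence ε_n → 0, both independent of i, such that for all sufficiently large n the probability of type I error of the full Bayes decision rule satisfies t^{FB}_{1i} ≤ C · α_n^{2a} / √(log(1/α_n²)) · (1 + ε_n) for every i = 1,…,n. -/
open MeasureTheory ProbabilityTheory Real Filter Set

noncomputable section

namespace PaperGL

lemma integrableOn_beta_kernel {u v : ℝ} (hu : 0 < u) (hv : 0 < v) :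
    IntegrableOn (fun κ : ℝ => κ ^ (u - 1) * (1 - κ) ^ (v - 1)) (Ioo 0 1) := by
  have hpdf : Integrable (betaPDFReal u v) := by
    refine ⟨(measurable_betaPDFReal u v).aestronglyMeasurable, ?_⟩
    rw [hasFiniteIntegral_iff_ofReal]
    · have := lintegral_betaPDF_eq_one hu hv
      simp only [betaPDF] at this
      rw [this]
      exact ENNReal.one_lt_top
    · refine Eventually.of_forall fun x => ?_
      by_cases hx : 0 < x ∧ x < 1
      · exact (betaPDFReal_pos hx.1 hx.2 hu hv).le
      · simp [betaPDFReal, hx]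
  refine ((hpdf.integrableOn (s := Ioo 0 1)).const_mul (beta u v)).congr ?_
  filter_upwards [ae_restrict_mem measurableSet_Ioo] with κ hκ
  have hb := (beta_pos hu hv).ne'
  rw [betaPDFReal, if_pos ⟨hκ.1, hκ.2⟩]
  field_simp

lemma kdens_nonneg {a : ℝ} {L : ℝ → ℝ} (hL : ∀ t, 0 < t → 0 < L t) (x : ℝ) {τ κ : ℝ}
    (hτ : 0 < τ) (hκ : κ ∈ Ioo (0 : ℝ) 1) : 0 ≤ kdens a L x τ κ := by
  have h1 : 0 < 1 - κ := sub_pos.2 hκ.2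
  have h2 : 0 < 1 / κ - 1 := sub_pos.2 (by rw [lt_div_iff₀ hκ.1]; linarith [hκ.2])
  have h3 := hL (1 / τ ^ 2 * (1 / κ - 1)) (by positivity)
  have := hκ.1
  unfold kdens
  positivity

/-- The unnormalised posterior mean of `1 - κ` is at most a constant times `exp (x² / 2)`. -/
lemma setIntegral_one_sub_mul_kdens_le {a : ℝ} (ha : 0 < a) (ha1 : a < 1) {L : ℝ → ℝ} {Mb : ℝ}
    (hpos : ∀ t, 0 < t → 0 < L t) (hle : ∀ t, 0 < t → L t ≤ Mb) (x : ℝ) {τ : ℝ} (hτ : 0 < τ) :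
    ∫ κ in Ioo (0 : ℝ) 1, (1 - κ) * kdens a L x τ κ ≤
      Mb * (∫ κ in Ioo (0 : ℝ) 1, κ ^ (a - 1 / 2) * (1 - κ) ^ (-a)) * Real.exp (x ^ 2 / 2) := by
  have hint : IntegrableOn (fun κ : ℝ => κ ^ (a - 1 / 2) * (1 - κ) ^ (-a)) (Ioo 0 1) := by
    have := integrableOn_beta_kernel (u := a + 1 / 2) (v := 1 - a) (by linarith) (by linarith)
    convert! this using 4 <;> ring
  rw [← integral_const_mul, ← integral_mul_const]
  refine integral_mono_of_nonneg ?_ ((hint.const_mul _).mul_const _) ?_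
  · filter_upwards [ae_restrict_mem measurableSet_Ioo] with κ hκ
    exact mul_nonneg (sub_nonneg.2 hκ.2.le) (kdens_nonneg hpos x hτ hκ)
  · filter_upwards [ae_restrict_mem measurableSet_Ioo] with κ hκ
    have h1 : 0 < 1 - κ := sub_pos.2 hκ.2
    have h2 : 0 < 1 / κ - 1 := sub_pos.2 (by rw [lt_div_iff₀ hκ.1]; linarith [hκ.2])
    have harg : 0 < 1 / τ ^ 2 * (1 / κ - 1) := by positivity
    have hLpos := hpos _ harg
    have hLle := hle _ harg
    have hMb := hLpos.le.trans hLle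
    have hpow : (1 - κ) ^ (-a) = (1 - κ) * (1 - κ) ^ (-a - 1) := by
      rw [Real.rpow_sub_one h1.ne']
      field_simp
    have hexp : Real.exp ((1 - κ) * x ^ 2 / 2) ≤ Real.exp (x ^ 2 / 2) := by
      refine Real.exp_le_exp.2 ?_
      nlinarith [mul_nonneg hκ.1.le (sq_nonneg x)]
    have hκ0 := hκ.1
    calc (1 - κ) * kdens a L x τ κ
        = κ ^ (a - 1 / 2) * (1 - κ) ^ (-a) *
            (L (1 / τ ^ 2 * (1 / κ - 1)) * Real.exp ((1 - κ) * x ^ 2 / 2)) := by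
          rw [hpow, kdens]; ring
      _ ≤ κ ^ (a - 1 / 2) * (1 - κ) ^ (-a) * (Mb * Real.exp (x ^ 2 / 2)) := by gcongr
      _ = _ := by ring

/-- The normalising constant of the posterior of `κ` is at least of order `τ ^ (-2a)`. -/
lemma le_setIntegral_kdens {a : ℝ} (ha : 0 < a) (ha1 : a < 1) {L : ℝ → ℝ} {c0 t0 : ℝ}
    (hpos : ∀ t, 0 < t → 0 < L t) (hc0 : 0 < c0) (ht0 : 0 < t0) (hge : ∀ t, t0 ≤ t → c0 ≤ L t)
    (x : ℝ) {τ : ℝ} (hτ : 0 < τ) (hsmall : t0 * τ ^ 2 ≤ 1 / 4)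
    (hint : IntegrableOn (kdens a L x τ) (Ioo 0 1)) :
    c0 / 2 * 2 ^ (-a - 1) * (t0 * τ ^ 2) ^ (-a) ≤ ∫ κ in Ioo (0 : ℝ) 1, kdens a L x τ κ := by
  set s := t0 * τ ^ 2 with hs
  have hs0 : 0 < s := by positivity
  have hsub : Ioo (1 - 2 * s) (1 - s) ⊆ Ioo (0 : ℝ) 1 := fun κ hκ =>
    ⟨by linarith [hκ.1], by linarith [hκ.2]⟩
  calc c0 / 2 * 2 ^ (-a - 1) * s ^ (-a)
      = ∫ _κ in Ioo (1 - 2 * s) (1 - s), 1 / 2 * (2 * s) ^ (-a - 1) * c0 := by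
        rw [setIntegral_const, measureReal_def, Real.volume_Ioo,
          ENNReal.toReal_ofReal (by linarith), Real.mul_rpow (by norm_num) hs0.le,
          Real.rpow_sub_one hs0.ne', smul_eq_mul]
        field_simp
        ring
    _ ≤ ∫ κ in Ioo (1 - 2 * s) (1 - s), kdens a L x τ κ := by
        refine setIntegral_mono_on (integrableOn_const (by simp)) (hint.mono_set hsub)
          measurableSet_Ioo fun κ hκ => ?_
        have hκ0 : 0 < κ := (hsub hκ).1
        have hκ1 : 0 < 1 - κ := sub_pos.2 (hsub hκ).2
        have hκhalf : 1 / 2 ≤ κ := by linarith [hκ.1]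
        have h1 : (1 / 2 : ℝ) ≤ κ ^ (a - 1 / 2) := by
          calc (1 / 2 : ℝ) ≤ κ := hκhalf
            _ = κ ^ (1 : ℝ) := (Real.rpow_one κ).symm
            _ ≤ κ ^ (a - 1 / 2) :=
              Real.rpow_le_rpow_of_exponent_ge hκ0 (hsub hκ).2.le (by linarith)
        have h2 : (2 * s) ^ (-a - 1) ≤ (1 - κ) ^ (-a - 1) :=
          Real.rpow_le_rpow_of_nonpos hκ1 (by linarith [hκ.1]) (by linarith)
        have ht : t0 ≤ 1 / τ ^ 2 * (1 / κ - 1) := by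
          have e : 1 / κ - 1 = (1 - κ) / κ := by field_simp
          have e2 : s ≤ (1 - κ) / κ := by
            rw [le_div_iff₀ hκ0]
            nlinarith [hκ.2, (hsub hκ).2]
          rw [e, one_div_mul_eq_div, le_div_iff₀ (by positivity)]
          exact e2
        have h3 := hge _ ht
        have h4 : 1 ≤ Real.exp ((1 - κ) * x ^ 2 / 2) := Real.one_le_exp (by positivity)
        unfold kdens
        calc 1 / 2 * (2 * s) ^ (-a - 1) * c0 = 1 / 2 * (2 * s) ^ (-a - 1) * c0 * 1 := by ring
          _ ≤ _ := by
            have := hpos _ (ht0.trans_le ht)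
            gcongr
    _ ≤ ∫ κ in Ioo (0 : ℝ) 1, kdens a L x τ κ := by
        refine setIntegral_mono_set hint ?_ (Eventually.of_forall hsub)
        filter_upwards [ae_restrict_mem measurableSet_Ioo] with κ hκ
        exact kdens_nonneg hpos x hτ hκ

/-- `E(1 - κ | x, τ) ≤ A τ ^ (2a) exp (x² / 2)` uniformly in `x` and in small `τ`. -/
lemma exists_E1mK_le {a : ℝ} (ha : 0 < a) (ha1 : a < 1) {L : ℝ → ℝ} {Mb c0 t0 : ℝ}
    (hL : AssumpL L Mb c0 t0) :
    ∃ A : ℝ, 0 < A ∧ ∀ x τ : ℝ, 0 < τ → t0 * τ ^ 2 ≤ 1 / 4 →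
      E1mK a L x τ ≤ A * τ ^ (2 * a) * Real.exp (x ^ 2 / 2) := by
  obtain ⟨-, hpos, hle, hc0, ht0, hge⟩ := hL
  have hMb : 0 < Mb := (hpos 1 one_pos).trans_le (hle 1 one_pos)
  set I := ∫ κ in Ioo (0 : ℝ) 1, κ ^ (a - 1 / 2) * (1 - κ) ^ (-a)
  have hI : 0 ≤ I := setIntegral_nonneg measurableSet_Ioo fun κ hκ =>
    mul_nonneg (Real.rpow_nonneg hκ.1.le _) (Real.rpow_nonneg (sub_nonneg.2 hκ.2.le) _)
  set B := c0 / 2 * 2 ^ (-a - 1) * t0 ^ (-a)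
  have hB : 0 < B := by positivity
  refine ⟨Mb * (I + 1) / B, by positivity, fun x τ hτ hsmall => ?_⟩
  unfold E1mK kExp
  by_cases hint : IntegrableOn (kdens a L x τ) (Ioo 0 1)
  · have hnum := setIntegral_one_sub_mul_kdens_le ha ha1 hpos hle x hτ
    have hden := le_setIntegral_kdens ha ha1 hpos hc0 ht0 hge x hτ hsmall hint
    have hτa : (t0 * τ ^ 2) ^ (-a) = t0 ^ (-a) * (τ ^ (2 * a))⁻¹ := by
      rw [Real.mul_rpow ht0.le (by positivity), Real.rpow_neg (by positivity : 0 ≤ τ ^ 2),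
        Real.rpow_mul hτ.le, Real.rpow_two]
    rw [hτa, ← mul_assoc] at hden
    have hτ2 : 0 < τ ^ (2 * a) := by positivity
    calc _ ≤ (Mb * (I + 1) * Real.exp (x ^ 2 / 2)) / (B * (τ ^ (2 * a))⁻¹) := by
          refine div_le_div₀ (by positivity) (hnum.trans ?_) (by positivity) hden
          gcongr
          exact le_add_of_nonneg_right zero_le_one
      _ = _ := by field_simp
  · rw [integral_undef (f := fun κ => kdens a L x τ κ) hint, div_zero]
    positivity

lemma marg_nonneg {a K : ℝ} (hK : 0 ≤ K) {L : ℝ → ℝ} (hpos : ∀ t, 0 < t → 0 < L t) (x τ : ℝ) :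
    0 ≤ marg a K L x τ := by
  refine setIntegral_nonneg measurableSet_Ioi fun l hl => ?_
  have hl : 0 < l := hl
  have := hpos l hl
  positivity

/-- A weighted average over `τ` of quantities bounded by `B` is bounded by `B`. -/
lemma fbShrink_le {a K : ℝ} (hK : 0 ≤ K) {L : ℝ → ℝ} (hpos : ∀ t, 0 < t → 0 < L t)
    {π2 : ℝ → ℝ} (hπ : ∀ τ, 0 ≤ π2 τ) {lo hi : ℝ} (hlo : 0 < lo) {n : ℕ} (X : Fin n → ℝ)
    (i : Fin n) {B : ℝ} (hB0 : 0 ≤ B) (hB : ∀ τ ∈ Icc lo hi, E1mK a L (X i) τ ≤ B) :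
    fbShrink a K L π2 lo hi n X i ≤ B := by
  set N : ℝ → ℝ := fun τ => π2 τ * ∏ j, marg a K L (X j) τ with hN
  have hN0 : ∀ τ, 0 ≤ N τ := fun τ =>
    mul_nonneg (hπ τ) (Finset.prod_nonneg fun j _ => marg_nonneg hK hpos (X j) τ)
  have hw : ∀ τ, tauWeight a K L π2 lo hi n X τ = N τ / ∫ s in Icc lo hi, N s := fun _ => rfl
  unfold fbShrink
  simp_rw [hw]
  by_cases hint : IntegrableOn N (Icc lo hi)
  · have hD : 0 ≤ ∫ s in Icc lo hi, N s := integral_nonneg hN0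
    have hE : ∀ τ ∈ Icc lo hi, 0 ≤ E1mK a L (X i) τ := fun τ hτ => by
      have hτ0 : 0 < τ := hlo.trans_le hτ.1
      exact div_nonneg
        (setIntegral_nonneg measurableSet_Ioo fun κ hκ =>
          mul_nonneg (sub_nonneg.2 hκ.2.le) (kdens_nonneg hpos _ hτ0 hκ))
        (setIntegral_nonneg measurableSet_Ioo fun κ hκ => kdens_nonneg hpos _ hτ0 hκ)
    calc _ ≤ ∫ τ in Icc lo hi, B * (N τ / ∫ s in Icc lo hi, N s) := by
          refine integral_mono_of_nonneg ?_ ((hint.div_const _).const_mul B) ?_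
          · filter_upwards [ae_restrict_mem measurableSet_Icc] with τ hτ
            exact mul_nonneg (hE τ hτ) (div_nonneg (hN0 τ) hD)
          · filter_upwards [ae_restrict_mem measurableSet_Icc] with τ hτ
            exact mul_le_mul_of_nonneg_right (hB τ hτ) (div_nonneg (hN0 τ) hD)
      _ = B * ((∫ s in Icc lo hi, N s) / ∫ s in Icc lo hi, N s) := by
          rw [integral_const_mul, integral_div]
      _ ≤ B := mul_le_of_le_one_right hB0 (div_self_le_one _)
  · rw [integral_undef (f := N) hint]
    simpa using hB0

lemma isProbabilityMeasure_mixM {p u : ℝ} (hp : 0 ≤ p ∧ p ≤ 1) :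
    IsProbabilityMeasure (mixM p u) := by
  refine ⟨?_⟩
  simp only [mixM, Measure.add_apply, Measure.smul_apply, measure_univ, smul_eq_mul, mul_one]
  rw [← ENNReal.ofReal_add (sub_nonneg.2 hp.2) hp.1, sub_add_cancel, ENNReal.ofReal_one]

lemma nullMeas_preimage_eval {n : ℕ} (i : Fin n) {p u : ℝ} (hp : 0 ≤ p ∧ p ≤ 1) {S : Set ℝ}
    (hS : MeasurableSet S) :
    nullMeas n i p u {x | x i ∈ S} = gaussianReal 0 1 S := by
  have hprob : ∀ j : Fin n,
      IsProbabilityMeasure (if j = i then gaussianReal 0 1 else mixM p u) := fun j => by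
    split_ifs
    · infer_instance
    · exact isProbabilityMeasure_mixM hp
  have h := (measurePreserving_eval
    (fun j : Fin n => if j = i then gaussianReal 0 1 else mixM p u) i).measure_preimage
    hS.nullMeasurableSet
  rw [if_pos rfl] at h
  exact h

lemma gaussianReal_Ioi_le {T : ℝ} (hT : 0 < T) :
    gaussianReal 0 1 (Ioi T) ≤ ENNReal.ofReal (Real.exp (-(T ^ 2 / 2)) / (2 * T)) := by
  rw [gaussianReal_apply_eq_integral 0 one_ne_zero]
  refine ENNReal.ofReal_le_ofReal ?_
  have hconst : (√(2 * π))⁻¹ ≤ 1 / 2 := by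
    rw [one_div]
    refine inv_anti₀ two_pos (Real.le_sqrt_of_sq_le ?_)
    linarith [Real.pi_gt_three]
  calc ∫ x in Ioi T, gaussianPDFReal 0 1 x
      ≤ ∫ x in Ioi T, 1 / 2 * Real.exp (T ^ 2 / 2) * Real.exp (-T * x) := by
        refine setIntegral_mono_on (integrable_gaussianPDFReal 0 1).integrableOn
          ((integrableOn_exp_mul_Ioi (by linarith) T).const_mul _) measurableSet_Ioi fun x _ => ?_
        simp only [gaussianPDFReal, NNReal.coe_one, mul_one, sub_zero]
        rw [mul_assoc, ← Real.exp_add]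
        gcongr
        nlinarith [sq_nonneg (x - T)]
    _ = Real.exp (-(T ^ 2 / 2)) / (2 * T) := by
        rw [integral_const_mul, integral_exp_mul_Ioi (by linarith)]
        have : Real.exp (-T * T) = Real.exp (-(T ^ 2 / 2)) * (Real.exp (T ^ 2 / 2))⁻¹ := by
          rw [← Real.exp_neg, ← Real.exp_add]; congr 1; ring
        rw [this]
        field_simp

/-- Mills-type two-sided tail bound for the standard normal distribution. -/
lemma gaussianReal_sq_gt_le {T : ℝ} (hT : 0 < T) :
    gaussianReal 0 1 {x : ℝ | T ^ 2 < x ^ 2} ≤ ENNReal.ofReal (Real.exp (-(T ^ 2 / 2)) / T) := by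
  have hsub : {x : ℝ | T ^ 2 < x ^ 2} ⊆ Ioi T ∪ (fun x => -x) ⁻¹' Ioi T := fun x hx => by
    have := sq_lt_sq.1 (show T ^ 2 < x ^ 2 from hx)
    rwa [abs_of_pos hT, lt_abs] at this
  have hneg : gaussianReal 0 1 ((fun x : ℝ => -x) ⁻¹' Ioi T) = gaussianReal 0 1 (Ioi T) := by
    rw [← Measure.map_apply measurable_neg measurableSet_Ioi, gaussianReal_map_neg, neg_zero]
  calc _ ≤ gaussianReal 0 1 (Ioi T) + gaussianReal 0 1 ((fun x : ℝ => -x) ⁻¹' Ioi T) :=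
        (measure_mono hsub).trans (measure_union_le _ _)
    _ ≤ ENNReal.ofReal (Real.exp (-(T ^ 2 / 2)) / (2 * T)) +
          ENNReal.ofReal (Real.exp (-(T ^ 2 / 2)) / (2 * T)) := by
        rw [hneg]
        exact add_le_add (gaussianReal_Ioi_le hT) (gaussianReal_Ioi_le hT)
    _ = ENNReal.ofReal (Real.exp (-(T ^ 2 / 2)) / T) := by
        rw [← ENNReal.ofReal_add (by positivity) (by positivity)]
        congr 1
        field_simp
        norm_num

/-- Type I error bound at a fixed sample size, given the shrinkage bound
`E(1 - κ | x, τ) ≤ A τ ^ (2a) exp (x² / 2)` on the support of the prior for `τ`. -/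
lemma t1FB_le {a K : ℝ} (ha : 0 < a) (hK : 0 ≤ K) {L : ℝ → ℝ} (hpos : ∀ t, 0 < t → 0 < L t)
    {π2 : ℕ → ℝ → ℝ} {α p u : ℕ → ℝ} {n : ℕ} (hn : 0 < n) (hπ : ∀ τ, 0 ≤ π2 n τ)
    (hp : 0 ≤ p n ∧ p n ≤ 1) {A : ℝ} (hA : 0 < A) (hα : 0 < α n)
    (hE : ∀ x : ℝ, ∀ τ ∈ Icc ((n : ℝ)⁻¹) (α n),
      E1mK a L x τ ≤ A * τ ^ (2 * a) * Real.exp (x ^ 2 / 2))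
    (hpow : 0 < Real.log (1 / α n ^ 2))
    (hlog : 2 * Real.log (2 * A) ≤ a * Real.log (1 / α n ^ 2)) (i : Fin n) :
    t1FB a K L π2 α p u n i ≤
      2 * A / √a * (α n ^ (2 * a) / √(Real.log (1 / α n ^ 2))) := by
  have hninv : 0 < (n : ℝ)⁻¹ := by positivity
  set b := 2 * A * α n ^ (2 * a) with hb
  have hb0 : 0 < b := by positivity
  set ℓ := Real.log (1 / α n ^ 2) with hℓ
  have hlogb : Real.log b = Real.log (2 * A) - a * ℓ := by
    rw [hb, hℓ, Real.log_mul (by positivity) (by positivity), Real.log_rpow hα, one_div,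
      Real.log_inv, Real.log_pow]
    push_cast
    ring
  have haℓ : 0 < a * ℓ := mul_pos ha hpow
  set T := √(-2 * Real.log b)
  have hTsq : T ^ 2 = -2 * Real.log b := Real.sq_sqrt (by linarith)
  have hT : √(a * ℓ) ≤ T := Real.sqrt_le_sqrt (by linarith)
  have hT0 : 0 < T := (Real.sqrt_pos.2 haℓ).trans_le hT
  have hexpT : Real.exp (-(T ^ 2 / 2)) = b := by
    rw [hTsq, show -(-2 * Real.log b / 2) = Real.log b by ring, Real.exp_log hb0]
  have hsub : {x | 1 / 2 < fbShrink a K L (π2 n) ((n : ℝ)⁻¹) (α n) n x i} ⊆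
      {x : Fin n → ℝ | x i ∈ {y : ℝ | T ^ 2 < y ^ 2}} := fun x hx => by
    have hle := fbShrink_le (a := a) hK hpos hπ hninv (hi := α n) x i
      (B := A * α n ^ (2 * a) * Real.exp (x i ^ 2 / 2)) (by positivity) fun τ hτ =>
        (hE (x i) τ hτ).trans (by
          have := hτ.2
          have := hninv.trans_le hτ.1
          gcongr)
    have hgt : 1 < b * Real.exp (x i ^ 2 / 2) := by
      have := lt_of_lt_of_le hx hle
      rw [hb]
      linarith
    have hlt := Real.log_pos hgt
    rw [Real.log_mul hb0.ne' (Real.exp_pos _).ne', Real.log_exp] at hlt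
    show T ^ 2 < x i ^ 2
    linarith
  have hmeas : MeasurableSet {y : ℝ | T ^ 2 < y ^ 2} :=
    measurableSet_lt measurable_const (by fun_prop)
  calc t1FB a K L π2 α p u n i ≤ Real.exp (-(T ^ 2 / 2)) / T := by
        refine ENNReal.toReal_le_of_le_ofReal (by positivity) ?_
        exact (measure_mono hsub).trans
          ((nullMeas_preimage_eval i hp hmeas).trans_le (gaussianReal_sq_gt_le hT0))
    _ ≤ b / √(a * ℓ) := by
        rw [hexpT]
        exact div_le_div_of_nonneg_left hb0.le (Real.sqrt_pos.2 haℓ) hT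
    _ = _ := by
        rw [Real.sqrt_mul ha.le, hb]
        field_simp

end PaperGL

open PaperGL MeasureTheory ProbabilityTheory Real Filter Set in
/-- Theorem 6: bound on the type I error probability of the full Bayes rule. -/
theorem stmt10 (a : ℝ) (ha : 0 < a ∧ a < 1) (L : ℝ → ℝ) (Mb c0 t0 K : ℝ)
    (hL : AssumpL L Mb c0 t0) (hK : Kcond a L K)
    (π2 : ℕ → ℝ → ℝ) (α : ℕ → ℝ) (hC3 : CondC3 π2 α)
    (p u : ℕ → ℝ) (hp : ∀ n, 0 ≤ p n ∧ p n ≤ 1) (hu : ∀ n, 0 < u n) :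
    ∃ C : ℝ, 0 < C ∧ ∃ ε : ℕ → ℝ, Tendsto ε atTop (nhds 0) ∧
      ∀ᶠ n : ℕ in atTop, ∀ i : Fin n,
        t1FB a K L π2 α p u n i ≤
          C * ((α n) ^ (2*a) / Real.sqrt (Real.log (1/(α n)^2))) * (1 + ε n) := by
  obtain ⟨ha0, ha1⟩ := ha
  obtain ⟨A, hA, hE⟩ := exists_E1mK_le ha0 ha1 hL
  obtain ⟨-, hpos, -, -, ht0, -⟩ := hL
  obtain ⟨-, hKpos, rfl⟩ := hK
  obtain ⟨hπ, -, -, hα0, hnα⟩ := hC3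
  have hαpos : ∀ᶠ n : ℕ in atTop, 0 < α n := by
    filter_upwards [hnα.eventually_gt_atTop 0] with n hn
    exact pos_of_mul_pos_right hn (Nat.cast_nonneg n)
  have hsq : Tendsto (fun n => α n ^ 2) atTop (nhds 0) := by simpa using hα0.pow 2
  have hlog : Tendsto (fun n => Real.log (1 / α n ^ 2)) atTop atTop := by
    simp_rw [one_div]
    refine Real.tendsto_log_atTop.comp (Tendsto.inv_tendsto_nhdsGT_zero ?_)
    refine tendsto_nhdsWithin_iff.2 ⟨hsq, ?_⟩
    filter_upwards [hαpos] with n hn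
    exact pow_pos hn 2
  have hsmall : ∀ᶠ n : ℕ in atTop, t0 * α n ^ 2 < 1 / 4 := by
    have : Tendsto (fun n => t0 * α n ^ 2) atTop (nhds 0) := by simpa using hsq.const_mul t0
    exact this.eventually_lt_const (by norm_num)
  refine ⟨2 * A / √a, by positivity, fun _ => 0, tendsto_const_nhds, ?_⟩
  filter_upwards [hαpos, hsmall, hlog.eventually_gt_atTop 0,
    (hlog.const_mul_atTop ha0).eventually_ge_atTop (2 * Real.log (2 * A)),
    eventually_gt_atTop 0] with n hα hs hl hl2 hn i
  rw [add_zero, mul_one]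
  refine t1FB_le ha0 (inv_pos.2 hKpos).le hpos hn (hπ n) (hp n) hA hα (fun x τ hτ => ?_) hl hl2 i
  have hτ0 : 0 < τ := (inv_pos.2 (Nat.cast_pos.2 hn)).trans_le hτ.1
  have := hτ.2
  refine hE x τ hτ0 (le_trans ?_ hs.le)
  gcongr
end
end
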